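/- Let n ≥ 1, let q = 3^n, let k be a field of characteristic 3, and let G = PSL_2(q) be the quotient of SL_2(q) by its center. Then every simple kG-module is algebraic. -/

import Mathlib

open CategoryTheory CategoryTheory.MonoidalCategory

namespace AlgebraicModule

variable {k G : Type} [Field k] [Monoid G]

/-- `N` is a direct summand of `M`, i.e. a retract of `M`. -/
def IsSummand (N M : FDRep k G) : Prop :=
  ∃ (i : N ⟶ M) (r : M ⟶ N), i ≫ r = 𝟙 N

/-- `M` is an indecomposable module: it is nonzero and is not the direct sum of two
nonzero submodules (equivalently, its only idempotent endomorphisms are `0` and `1`). -/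
def Indecomposable (M : FDRep k G) : Prop :=
  ¬ Limits.IsZero M ∧ ∀ e : M ⟶ M, e ≫ e = e → e = 0 ∨ e = 𝟙 M

/-- `tensorPow M n` is the tensor power `M^{⊗ (n + 1)}`, with diagonal `G`-action. -/
noncomputable def tensorPow (M : FDRep k G) : ℕ → FDRep k G
  | 0 => M
  | n + 1 => tensorPow M n ⊗ M

/-- `M` is algebraic: only finitely many isomorphism classes of indecomposable modules
occur as direct summands of the tensor powers `M^{⊗ n}` for `n ≥ 1`. -/
noncomputable def IsAlgebraic (M : FDRep k G) : Prop :=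
  ∃ L : List (FDRep k G), ∀ N : FDRep k G, Indecomposable N →
    (∃ n : ℕ, IsSummand N (tensorPow M n)) → ∃ N' ∈ L, Nonempty (N ≅ N')

end AlgebraicModule

open AlgebraicModule

/-- `PSL_n(F)`: the quotient of `SL_n(F)` by its center. -/
abbrev PSL (n : ℕ) (F : Type) [Field F] : Type :=
  Matrix.SpecialLinearGroup (Fin n) F ⧸ Subgroup.center (Matrix.SpecialLinearGroup (Fin n) F)


section
set_option linter.all false
set_option linter.unusedSectionVars false
set_option linter.unusedSimpArgs false

namespace SLA

/-- iterated Frobenius -/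
noncomputable abbrev fr {K : Type} [Field K] [CharP K 3] (i : ℕ) : K →+* K := iterateFrobenius K 3 i

/-- twisted tensor monomials of a 2x2 matrix -/
noncomputable def mon {K : Type} [Field K] [CharP K 3] {m : Type} [Fintype m] (c : m → ℕ)
    (A : Matrix (Fin 2) (Fin 2) K) : Matrix (m → Fin 2) (m → Fin 2) K :=
  Matrix.of fun s t => ∏ j, fr (c j) (A (s j) (t j))

section
variable {K : Type} [Field K] [CharP K 3]
variable {m m' m'' : Type} [Fintype m] [Fintype m'] [Fintype m'']
  [DecidableEq m] [DecidableEq m'] [DecidableEq m'']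

lemma mon_apply (c : m → ℕ) (A : Matrix (Fin 2) (Fin 2) K) (s t) :
    mon c A s t = ∏ j, fr (c j) (A (s j) (t j)) := rfl

lemma mon_mul (c : m → ℕ) (A B : Matrix (Fin 2) (Fin 2) K) :
    mon c (A * B) = mon c A * mon c B := by
  ext s t
  simp only [mon_apply, Matrix.mul_apply, map_sum, map_mul]
  rw [Finset.prod_univ_sum]
  simp [Fintype.piFinset_univ, Finset.prod_mul_distrib]

lemma mon_one (c : m → ℕ) : mon c (1 : Matrix (Fin 2) (Fin 2) K) = 1 := by
  ext s t
  simp only [mon_apply, Matrix.one_apply]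
  by_cases h : s = t
  · subst h; simp
  · obtain ⟨j, hj⟩ := Function.ne_iff.1 h
    rw [if_neg h]
    exact Finset.prod_eq_zero (Finset.mem_univ j) (by simp [hj])

variable {F : Type} [Field F] (ι : F →+* K)

/-- image of a group element in matrices over `K` -/
def em (g : Matrix.SpecialLinearGroup (Fin 2) F) : Matrix (Fin 2) (Fin 2) K := g.1.map ι

lemma em_mul (g h) : em ι (g * h) = em ι g * em ι h := by
  simp [em, Matrix.map_mul]

lemma em_one : em ι 1 = 1 := by
  simp [em]

lemma em_det (g) : (em ι g) 0 0 * (em ι g) 1 1 - (em ι g) 0 1 * (em ι g) 1 0 = 1 := by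
  have h := g.2
  rw [Matrix.det_fin_two] at h
  have := congrArg ι h
  simpa [em] using this

/-- intertwining matrices -/
def MHom (c : m → ℕ) (c' : m' → ℕ) (P : Matrix (m' → Fin 2) (m → Fin 2) K) : Prop :=
  ∀ g, P * mon c (em ι g) = mon c' (em ι g) * P

/-- ideal of endomorphisms factoring through small monomials -/
def MJ (B : ℕ) (c : m → ℕ) : AddSubgroup (Matrix (m → Fin 2) (m → Fin 2) K) :=
  AddSubgroup.closure {X | ∃ (r : ℕ) (_ : r ≤ B) (c' : Fin r → ℕ)
    (Q : Matrix (m → Fin 2) (Fin r → Fin 2) K) (P : Matrix (Fin r → Fin 2) (m → Fin 2) K),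
    MHom ι c' c Q ∧ MHom ι c c' P ∧ X = Q * P}

variable {ι}

lemma MHom.mul {c : m → ℕ} {c' : m' → ℕ} {c'' : m'' → ℕ} {P : Matrix (m'' → Fin 2) (m' → Fin 2) K}
    {Q : Matrix (m' → Fin 2) (m → Fin 2) K} (hP : MHom ι c' c'' P) (hQ : MHom ι c c' Q) :
    MHom ι c c'' (P * Q) := by
  intro g
  rw [Matrix.mul_assoc, hQ g, ← Matrix.mul_assoc, hP g, Matrix.mul_assoc]

lemma MHom.one {c : m → ℕ} : MHom ι c c 1 := by intro g; simp

lemma MJ.mul_mul {B : ℕ} {c : m → ℕ} {c' : m' → ℕ} {X} (hX : X ∈ MJ ι B c)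
    {P : Matrix (m' → Fin 2) (m → Fin 2) K} {Q : Matrix (m → Fin 2) (m' → Fin 2) K}
    (hP : MHom ι c c' P) (hQ : MHom ι c' c Q) : P * X * Q ∈ MJ ι B c' := by
  induction hX using AddSubgroup.closure_induction with
  | mem x hx =>
    obtain ⟨r, hr, d, Q', P', h1, h2, rfl⟩ := hx
    apply AddSubgroup.subset_closure
    exact ⟨r, hr, d, P * Q', P' * Q, hP.mul h1, h2.mul hQ, by simp only [Matrix.mul_assoc]⟩
  | zero => simp
  | add x y _ _ h1 h2 => rw [Matrix.mul_add, Matrix.add_mul]; exact add_mem h1 h2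
  | neg x _ h => rw [Matrix.mul_neg, Matrix.neg_mul]; exact neg_mem h

lemma MJ.mono {B B' : ℕ} (h : B ≤ B') {c : m → ℕ} {X} (hX : X ∈ MJ ι B c) : X ∈ MJ ι B' c := by
  refine AddSubgroup.closure_mono ?_ hX
  rintro x ⟨r, hr, h'⟩
  exact ⟨r, hr.trans h, h'⟩

/-- reindexing -/
def RI (K : Type) [Field K] {m m' : Type} [Fintype m] [DecidableEq m] (e : m ≃ m') :
    Matrix (m' → Fin 2) (m → Fin 2) K :=
  Matrix.of fun s t => if s ∘ e = t then 1 else 0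

lemma RI_hom (e : m ≃ m') (c : m → ℕ) (c' : m' → ℕ) (h : ∀ j, c' (e j) = c j) :
    MHom ι c c' (RI K e) := by
  intro g
  ext s t
  simp only [Matrix.mul_apply, RI, Matrix.of_apply, ite_mul, one_mul, zero_mul, mul_ite, mul_one,
    mul_zero]
  rw [Finset.sum_ite_eq]
  rw [Finset.sum_eq_single (t ∘ e.symm)]
  · simp only [Finset.mem_univ, if_true]
    have : (t ∘ e.symm) ∘ e = t := by ext; simp
    rw [if_pos this, mon_apply, mon_apply, ← e.prod_comp]
    simp [h]
  · intro b _ hb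
    rw [if_neg]
    rintro rfl
    apply hb
    ext; simp
  · simp

lemma RI_mul (e : m ≃ m') (f : m' ≃ m'') : RI K f * RI K e = RI K (e.trans f) := by
  ext s t
  simp only [Matrix.mul_apply, RI, Matrix.of_apply, ite_mul, one_mul, zero_mul]
  rw [Finset.sum_ite_eq, if_pos (Finset.mem_univ _)]
  rfl

lemma RI_refl : RI K (Equiv.refl m) = 1 := by
  ext s t
  simp [RI, Matrix.one_apply]

lemma MJ.of_equiv {B : ℕ} (e : m ≃ m') (c : m → ℕ) (c' : m' → ℕ) (h : ∀ j, c' (e j) = c j)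
    (h1 : 1 ∈ MJ ι B c) : 1 ∈ MJ ι B c' := by
  have := MJ.mul_mul h1 (RI_hom e c c' h) (RI_hom e.symm c' c (fun j => by rw [← h]; simp))
  rw [Matrix.mul_one, RI_mul] at this
  simpa [RI_refl] using this

/-- extension by the identity -/
def ex (n : Type) [Fintype n] [DecidableEq n] (P : Matrix (m' → Fin 2) (m → Fin 2) K) :
    Matrix (m' ⊕ n → Fin 2) (m ⊕ n → Fin 2) K :=
  Matrix.of fun s t => if s ∘ Sum.inr = t ∘ Sum.inr then P (s ∘ Sum.inl) (t ∘ Sum.inl) else 0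

lemma sum_sum {n : Type} [Fintype n] [DecidableEq n] (f : (m ⊕ n → Fin 2) → K) :
    ∑ s, f s = ∑ a : m → Fin 2, ∑ b : n → Fin 2, f (Sum.elim a b) := by
  rw [← Fintype.sum_prod_type', ← (Equiv.sumArrowEquivProdArrow m n (Fin 2)).symm.sum_comp]
  rfl

lemma ex_apply {n : Type} [Fintype n] [DecidableEq n] (P : Matrix (m' → Fin 2) (m → Fin 2) K)
    (a b a' b') : ex n P (Sum.elim a b) (Sum.elim a' b') = if b = b' then P a a' else 0 := rfl

lemma sum_form {n : Type} (s : m ⊕ n → Fin 2) : ∃ a b, s = Sum.elim a b :=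
  ⟨s ∘ Sum.inl, s ∘ Sum.inr, by simp⟩

lemma mon_sum {n : Type} [Fintype n] [DecidableEq n] (c : m → ℕ) (d : n → ℕ)
    (A : Matrix (Fin 2) (Fin 2) K) (a b a' b') :
    mon (Sum.elim c d) A (Sum.elim a b) (Sum.elim a' b') = mon c A a a' * mon d A b b' := by
  simp [mon_apply]

lemma ex_mul {n : Type} [Fintype n] [DecidableEq n] (P : Matrix (m'' → Fin 2) (m' → Fin 2) K)
    (Q : Matrix (m' → Fin 2) (m → Fin 2) K) : ex n (P * Q) = ex n P * ex n Q := by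
  ext s t
  obtain ⟨a, b, rfl⟩ := sum_form s
  obtain ⟨a', b', rfl⟩ := sum_form t
  rw [ex_apply, Matrix.mul_apply, Matrix.mul_apply, sum_sum]
  simp only [ex_apply]
  by_cases h : b = b'
  · subst h
    rw [if_pos rfl]
    refine Finset.sum_congr rfl fun x _ => ?_
    rw [Finset.sum_eq_single b]
    · simp
    · intro y _ hy; rw [if_neg hy.symm, zero_mul]
    · simp
  · rw [if_neg h]
    symm
    refine Finset.sum_eq_zero fun x _ => Finset.sum_eq_zero fun y _ => ?_
    by_cases h1 : b = y
    · subst h1; rw [if_neg h, mul_zero]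
    · rw [if_neg h1, zero_mul]

lemma ex_hom {n : Type} [Fintype n] [DecidableEq n] (c : m → ℕ) (c' : m' → ℕ) (d : n → ℕ)
    {P : Matrix (m' → Fin 2) (m → Fin 2) K} (hP : MHom ι c c' P) :
    MHom ι (Sum.elim c d) (Sum.elim c' d) (ex n P) := by
  intro g
  ext s t
  obtain ⟨a, b, rfl⟩ := sum_form s
  obtain ⟨a', b', rfl⟩ := sum_form t
  have h := congrFun (congrFun (hP g) a) a'
  rw [Matrix.mul_apply, Matrix.mul_apply] at h
  rw [Matrix.mul_apply, Matrix.mul_apply, sum_sum, sum_sum]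
  simp only [ex_apply, mon_sum]
  trans (∑ x, P a x * mon c (em ι g) x a') * mon d (em ι g) b b'
  · rw [Finset.sum_mul]
    refine Finset.sum_congr rfl fun x _ => ?_
    rw [Finset.sum_eq_single b]
    · rw [if_pos rfl, mul_assoc]
    · intro y _ hy; rw [if_neg hy.symm, zero_mul]
    · simp
  · rw [h, Finset.sum_mul]
    refine Finset.sum_congr rfl fun x _ => ?_
    rw [Finset.sum_eq_single b']
    · rw [if_pos rfl]; ring
    · intro y _ hy; rw [if_neg hy, mul_zero]
    · simp

lemma ex_one {n : Type} [Fintype n] [DecidableEq n] : ex n (1 : Matrix (m → Fin 2) (m → Fin 2) K) = 1 := by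
  ext s t
  simp only [ex, Matrix.of_apply, Matrix.one_apply, ← ite_and]
  congr 1
  rw [eq_iff_iff]
  constructor
  · rintro ⟨h1, h2⟩
    ext (j | j)
    · exact congrArg _ (congrFun h2 j)
    · exact congrArg _ (congrFun h1 j)
  · rintro rfl; simp

lemma MJ.ex {B : ℕ} {n : Type} [Fintype n] [DecidableEq n] (c : m → ℕ) (d : n → ℕ) {X}
    (hX : X ∈ MJ ι B c) : ex n X ∈ MJ ι (B + Fintype.card n) (Sum.elim c d) := by
  induction hX using AddSubgroup.closure_induction with
  | mem x hx =>
    obtain ⟨r, hr, d', Q', P', h1, h2, rfl⟩ := hx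
    apply AddSubgroup.subset_closure
    let e : Fin r ⊕ n ≃ Fin (r + Fintype.card n) :=
      (Equiv.sumCongr (Equiv.refl _) (Fintype.equivFin n)).trans finSumFinEquiv
    have e1 : MHom ι _ _ _ := RI_hom (ι := ι) e (Sum.elim d' d) ((Sum.elim d' d) ∘ e.symm) (by simp)
    have e2 : MHom ι _ _ _ :=
      RI_hom (ι := ι) e.symm ((Sum.elim d' d) ∘ e.symm) (Sum.elim d' d) (by simp)
    refine ⟨_, by omega, _, SLA.ex n Q' * RI K e.symm, RI K e * SLA.ex n P', (ex_hom _ _ _ h1).mul e2,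
      e1.mul (ex_hom _ _ _ h2), ?_⟩
    rw [Matrix.mul_assoc, ← Matrix.mul_assoc (RI K e.symm), RI_mul, ex_mul]
    simp [RI_refl]
  | zero => 
    convert zero_mem (MJ ι (B + Fintype.card n) (Sum.elim c d))
    ext s t; simp [SLA.ex]
  | add x y _ _ h1 h2 =>
    convert add_mem h1 h2
    ext s t; simp only [SLA.ex, Matrix.of_apply, Matrix.add_apply]; split_ifs <;> simp
  | neg x _ h => 
    convert neg_mem h
    ext s t; simp only [SLA.ex, Matrix.of_apply, Matrix.neg_apply]; split_ifs <;> simp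

end
end SLA

end


section
set_option linter.all false
namespace SLA
/-- sign -/
def sg (K : Type) [Field K] (a b : Fin 2) : K := if a = b then 1 else -1

open Polynomial in
/-- linear forms -/
noncomputable def lf {K : Type} [Field K] (x : Fin 2 → Fin 2 → K) (v : Fin 2) : K[X] := C (x 0 v) + C (x 1 v) * X

open Polynomial in
lemma coreP {K : Type} [Field K] [CharP K 3] (x : Fin 2 → Fin 2 → K) (t : Fin 5 → Fin 2) (M : ℕ) :
    (∑ s : Fin 5 → Fin 2, if M = ∑ j, (s j).1 then ∏ j, x (s j) (t j) else 0) =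
      (∏ j, lf x (t j)).coeff M := by
  have : ∀ v, lf x v = ∑ u : Fin 2, C (x u v) * X ^ u.1 := by
    intro v; simp [lf, Fin.sum_univ_two]
  simp only [this]
  rw [Finset.prod_univ_sum, finset_sum_coeff]
  simp only [Fintype.piFinset_univ]
  refine Finset.sum_congr rfl fun s _ => ?_
  rw [Finset.prod_mul_distrib, Finset.prod_pow_eq_pow_sum, ← map_prod, coeff_C_mul_X_pow]

lemma coreQ {K : Type} [Field K] (x : Fin 2 → Fin 2 → K) (t : Fin 5 → Fin 2) :
   (∏ j, lf x (t j)) = lf x 0 ^ (5 - ∑ j, (t j).1) * lf x 1 ^ (∑ j, (t j).1) := by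
  have h : ∀ v, lf x v = lf x 0 ^ (1 - v.1) * lf x 1 ^ v.1 := by
    intro v; fin_cases v <;> simp
  have h2 : ∑ j, (1 - (t j).1) = 5 - ∑ j, (t j).1 := by
    have : ∑ j, (1 - (t j).1) + ∑ j, (t j).1 = 5 := by
      rw [← Finset.sum_add_distrib]
      trans ∑ j : Fin 5, 1
      · refine Finset.sum_congr rfl fun j _ => by omega
      · simp
    omega
  conv_lhs => enter [2, j]; rw [h]
  rw [Finset.prod_mul_distrib, Finset.prod_pow_eq_pow_sum, Finset.prod_pow_eq_pow_sum, h2]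

open Polynomial in
lemma core {K : Type} [Field K] [CharP K 3] (x : Fin 2 → Fin 2 → K) (r0 r1 r2 : Fin 2) (t : Fin 5 → Fin 2) :
    sg K r0 r1 * (∑ s : Fin 5 → Fin 2, if r0.1 + r1.1 + 3 * r2.1 = ∑ j, (s j).1 then ∏ j, x (s j) (t j) else 0) =
    ∑ a : Fin 2, ∑ b : Fin 2, ∑ c : Fin 2,
      if a.1 + b.1 + 3 * c.1 = ∑ j, (t j).1 then sg K a b * (x r0 a * x r1 b * (x r2 c) ^ 3) else 0 := by
  rw [coreP, coreQ]
  have hN : ∑ j, (t j).1 ≤ 5 := by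
    trans ∑ j : Fin 5, 1
    · exact Finset.sum_le_sum fun j _ => by omega
    · simp
  generalize ∑ j, (t j).1 = N at *
  have h3 : ∀ v, lf x v ^ 3 = C (x 0 v ^ 3) + C (x 1 v ^ 3) * X ^ 3 := by
    intro v
    rw [lf, add_pow_char, mul_pow, ← C_pow, ← C_pow]
  have key : ∀ v w c, lf x v * lf x w * lf x c ^ 3 = C (x 0 v * x 0 w * x 0 c ^ 3)
     + C ((x 0 v * x 1 w + x 1 v * x 0 w) * x 0 c ^ 3) * X
     + C ((x 1 v * x 1 w) * x 0 c ^ 3) * X ^ 2 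
     + C ((x 0 v * x 0 w) * x 1 c ^ 3) * X ^ 3 
     + C ((x 0 v * x 1 w + x 1 v * x 0 w) * x 1 c ^ 3) * X ^ 4
     + C ((x 1 v * x 1 w) * x 1 c ^ 3) * X ^ 5 := by
    intro v w c
    rw [h3, lf, lf]
    simp only [C_mul, C_add, C_pow]
    ring
  have two : (3 : K) = 0 := by exact_mod_cast CharP.cast_eq_zero K 3
  have hk : ∃ v w c : Fin 2, v.1 + w.1 + 3 * c.1 = N ∧ v ≤ w ∧ 
     lf x 0 ^ (5 - N) * lf x 1 ^ N = lf x v * lf x w * lf x c ^ 3 := by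
    interval_cases N
    · exact ⟨0, 0, 0, by simp, by simp, by ring⟩
    · exact ⟨0, 1, 0, by simp, by simp, by ring⟩
    · exact ⟨1, 1, 0, by simp, by simp, by ring⟩
    · exact ⟨0, 0, 1, by simp, by simp, by ring⟩
    · exact ⟨0, 1, 1, by simp, by simp, by ring⟩
    · exact ⟨1, 1, 1, by simp, by simp, by ring⟩
  obtain ⟨v, w, c, rfl, hvw, e⟩ := hk
  rw [e, key]
  simp only [coeff_add, coeff_C_mul, coeff_X_pow, coeff_X, coeff_C]
  clear key h3 e hN
  revert hvw
  fin_cases v <;> fin_cases w <;> fin_cases c <;> intro hvw <;> first | (exfalso; revert hvw; decide; done) | skip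
  all_goals
    fin_cases r0 <;> fin_cases r1 <;> fin_cases r2 <;> simp [Fin.sum_univ_two, sg] <;> first | ring1 | grind

/-- binary digits -/
def ts (s x : ℕ) : ℕ := (s / 2 ^ x) % 2
/-- weight -/
def wg (s : ℕ) : ℕ := ts s 0 + ts s 1 + ts s 2 + ts s 3 + ts s 4
/-- affine action on bit strings -/
def ac (a b s : ℕ) : ℕ := ts s (b%5) + 2 * ts s ((a + b)%5) + 4 * ts s ((2*a+b)%5) +
  8 * ts s ((3*a+b)%5) + 16 * ts s ((4*a+b)%5)
/-- counting -/
def cnt (s t : ℕ) : ℕ := ∑ a : Fin 4, ∑ b : Fin 5, if ac (a.1+1) b.1 s = t then 1 else 0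
/-- the other count -/
def wt (s t : ℕ) : ℕ := if wg s = wg t then (if wg s % 3 = 1 then 2 else 1) else 0

lemma core2 : ∀ s < 32, ∀ t < 32, (wt s t + cnt s t) % 3 = 0 := by
  decide +kernel

/-- encoding -/
def en (s : Fin 5 → Fin 2) : ℕ := (s 0).1 + 2 * (s 1).1 + 4 * (s 2).1 + 8 * (s 3).1 + 16 * (s 4).1

lemma en_lt (s) : en s < 32 := by unfold en; omega

lemma ts_en (s : Fin 5 → Fin 2) (x : Fin 5) : ts (en s) x.1 = (s x).1 := by
  unfold ts en
  fin_cases x <;> simp <;> omega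

/-- affine permutations -/
def aff (a : Fin 4) (b : Fin 5) : Equiv.Perm (Fin 5) where
  toFun x := ![1,2,3,4] a * x + b
  invFun x := ![1,3,2,4] a * (x - b)
  left_inv := by revert a b; unfold Function.LeftInverse; decide
  right_inv := by revert a b; unfold Function.RightInverse Function.LeftInverse; decide

lemma ac_en (a : Fin 4) (b : Fin 5) (s t : Fin 5 → Fin 2) :
    ac (a.1+1) b.1 (en s) = en t ↔ s ∘ aff a b = t := by
  have h : ∀ x : Fin 5, ts (en s) (((a.1+1) * x.1 + b.1) % 5) = (s (aff a b x)).1 := by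
    intro x
    rw [← ts_en s (aff a b x)]
    congr 1
    revert a b x
    decide
  have h0 := h 0
  have h1 := h 1
  have h2 := h 2
  have h3 := h 3
  have h4 := h 4
  simp at h0 h1 h2 h3 h4
  rw [funext_iff, Fin.forall_fin_succ,Fin.forall_fin_succ,Fin.forall_fin_succ,Fin.forall_fin_succ,Fin.forall_fin_succ]
  simp only [ac, en.eq_1 t]
  rw [mul_comm 2 (a.1+1), mul_comm 3 (a.1+1), mul_comm 4 (a.1+1), h0, h1, h2, h3, h4]
  simp [Fin.ext_iff, Fin.forall_fin_zero_pi]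
  omega

lemma cnt_eq (s t : Fin 5 → Fin 2) : cnt (en s) (en t) = 
   ∑ a : Fin 4, ∑ b : Fin 5, if s ∘ aff a b = t then 1 else 0 := by
  unfold cnt
  simp only [ac_en]

lemma wg_eq (s : Fin 5 → Fin 2) : wg (en s) = ∑ j, (s j).1 := by
  have := fun x => ts_en s x
  have h0 := this 0
  have h1 := this 1
  have h2 := this 2
  have h3 := this 3
  have h4 := this 4
  simp at h0 h1 h2 h3 h4
  simp [wg, Fin.sum_univ_succ, h0, h1, h2, h3, h4]
  omega

lemma wt_eq (s t : Fin 5 → Fin 2) : wt (en s) (en t) = 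
   ∑ a : Fin 2, ∑ b : Fin 2, ∑ c : Fin 2, if a.1 + b.1 + 3 * c.1 = ∑ j, (s j).1 ∧ a.1 + b.1 + 3 * c.1 = ∑ j, (t j).1 then 1 else 0 := by
  unfold wt
  rw [wg_eq, wg_eq]
  have hN : ∀ t : Fin 5 → Fin 2, ∑ j, (t j).1 < 6 := by
    intro t
    have : ∑ j, (t j).1 ≤ ∑ j : Fin 5, 1 := Finset.sum_le_sum fun j _ => by omega
    simp at this
    omega
  have h1 := hN s
  have h2 := hN t
  generalize ∑ j, (t j).1 = N at *
  generalize ∑ j, (s j).1 = M at *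
  clear hN
  revert N M
  decide

lemma core3 {K : Type} [Field K] [CharP K 3] (s t : Fin 5 → Fin 2) :
    (∑ a : Fin 2, ∑ b : Fin 2, ∑ c : Fin 2, if a.1 + b.1 + 3 * c.1 = ∑ j, (s j).1 ∧ a.1 + b.1 + 3 * c.1 = ∑ j, (t j).1 then (1 : K) else 0)
    = - ∑ a : Fin 4, ∑ b : Fin 5, if s ∘ aff a b = t then 1 else 0 := by
  have h := core2 _ (en_lt s) _ (en_lt t)
  have h' := (CharP.cast_eq_zero_iff K 3 _).2 (Nat.dvd_of_mod_eq_zero h)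
  rw [cnt_eq, wt_eq] at h'
  push_cast at h'
  exact eq_neg_of_add_eq_zero_left h'

end SLA

end


section
set_option linter.all false
namespace SLA
section
variable {K : Type} [Field K] [CharP K 3] {F : Type} [Field F] (ι : F →+* K)

lemma sum_fin2 (f : (Fin 2 → Fin 2) → K) : ∑ s, f s = ∑ a : Fin 2, ∑ b : Fin 2, f ![a, b] := by
  rw [← Fintype.sum_prod_type', ← (finTwoArrowEquiv (Fin 2)).symm.sum_comp]
  rfl

/-- triples -/
def tri : Fin 2 × Fin 2 × Fin 2 ≃ (Fin 3 → Fin 2) where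
  toFun p := ![p.1, p.2.1, p.2.2]
  invFun s := (s 0, s 1, s 2)
  left_inv p := rfl
  right_inv s := by ext j; fin_cases j <;> rfl

lemma sum_fin3 (f : (Fin 3 → Fin 2) → K) :
    ∑ s, f s = ∑ a : Fin 2, ∑ b : Fin 2, ∑ c : Fin 2, f ![a, b, c] := by
  rw [← tri.sum_comp, Fintype.sum_prod_type]
  refine Finset.sum_congr rfl fun a _ => ?_
  rw [Fintype.sum_prod_type]
  rfl

/-- the symplectic form -/
def om (t : Fin 2 → Fin 2) : K := ((t 1).1 : K) - ((t 0).1 : K)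

lemma cup (i : ℕ) : MHom ι (fun _ : Fin 0 => 0) (fun _ : Fin 2 => i) (Matrix.of fun s _ => om s) := by
  intro g
  have h : fr i _ = fr i _ := congrArg (fr i) (em_det ι g)
  rw [map_sub, map_mul, map_mul, map_one] at h
  ext s t
  rw [Matrix.mul_apply, Matrix.mul_apply, sum_fin2, Fintype.sum_unique]
  simp only [mon_apply, Matrix.of_apply, om, Fin.prod_univ_two, Fin.sum_univ_two]
  obtain ⟨⟨a, b⟩, rfl⟩ := (finTwoArrowEquiv (Fin 2)).symm.surjective s
  fin_cases a <;> fin_cases b <;> simp [finTwoArrowEquiv] <;> first | (linear_combination h) | (linear_combination -h) | (linear_combination 0 * h)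

lemma cap (i : ℕ) : MHom ι (fun _ : Fin 2 => i) (fun _ : Fin 0 => 0) (Matrix.of fun _ s => om s) := by
  intro g
  have h : fr i _ = fr i _ := congrArg (fr i) (em_det ι g)
  rw [map_sub, map_mul, map_mul, map_one] at h
  ext t s
  rw [Matrix.mul_apply, Matrix.mul_apply, sum_fin2, Fintype.sum_unique (ι := Fin 0 → Fin 2)]
  simp only [mon_apply, Matrix.of_apply, om, Fin.prod_univ_two, Fin.sum_univ_two]
  obtain ⟨⟨a, b⟩, rfl⟩ := (finTwoArrowEquiv (Fin 2)).symm.surjective s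
  fin_cases a <;> fin_cases b <;> simp [finTwoArrowEquiv] <;> first | (linear_combination h) | (linear_combination -h) | (linear_combination 0 * h)

lemma swap2 (i : ℕ) : 1 - RI K (Equiv.swap (0 : Fin 2) 1) ∈ MJ ι 0 (fun _ : Fin 2 => i) := by
  apply AddSubgroup.subset_closure
  refine ⟨0, le_rfl, _, _, _, cup ι i, cap ι i, ?_⟩
  ext s t
  rw [Matrix.mul_apply, Fintype.sum_unique]
  obtain ⟨⟨a, b⟩, rfl⟩ := (finTwoArrowEquiv (Fin 2)).symm.surjective s
  obtain ⟨⟨a', b'⟩, rfl⟩ := (finTwoArrowEquiv (Fin 2)).symm.surjective t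
  simp only [Matrix.sub_apply, Matrix.one_apply, RI, Matrix.of_apply, funext_iff, Fin.forall_fin_two, om]
  fin_cases a <;> fin_cases b <;> fin_cases a' <;> fin_cases b' <;> simp [finTwoArrowEquiv]

lemma ex_sub {m m' n : Type} [Fintype m] [Fintype m'] [DecidableEq m] [DecidableEq m'] [Fintype n] [DecidableEq n] (P Q : Matrix (m' → Fin 2) (m → Fin 2) K) :
    ex n (P - Q) = ex n P - ex n Q := by
  ext s t; simp only [SLA.ex, Matrix.of_apply, Matrix.sub_apply]; split_ifs <;> simp

lemma ex_RI {m n : Type} [Fintype m] [DecidableEq m] [Fintype n] [DecidableEq n] (w : m ≃ m) :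
    ex n (RI K w) = RI K (Equiv.sumCongr w (Equiv.refl n)) := by
  ext s t
  obtain ⟨a, b, rfl⟩ := sum_form s
  obtain ⟨a', b', rfl⟩ := sum_form t
  rw [ex_apply]
  simp only [RI, Matrix.of_apply, ← ite_and]
  congr 1
  rw [eq_iff_iff]
  constructor
  · rintro ⟨rfl, rfl⟩
    ext (j | j) <;> simp
  · intro h
    constructor
    · ext j; exact congrArg Fin.val (congrFun h (Sum.inr j))
    · ext j; exact congrArg Fin.val (congrFun h (Sum.inl j))

lemma swap5 (i : ℕ) : ∃ a b : Fin 5, a ≠ b ∧ 1 - RI K (Equiv.swap a b) ∈ MJ ι 3 (fun _ : Fin 5 => i) := by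
  have h := MJ.ex (n := Fin 3) (ι := ι) (fun _ : Fin 2 => i) (fun _ => i) (swap2 ι i)
  let e : Fin 2 ⊕ Fin 3 ≃ Fin 5 := finSumFinEquiv
  have h2 := MJ.mul_mul h (RI_hom (ι := ι) e _ (fun _ => i) (by rintro (j | j) <;> rfl))
    (RI_hom (ι := ι) e.symm (fun _ => i) _ (by intro j; rcases e.symm j with (j | j) <;> rfl))
  rw [ex_sub, ex_RI, ex_one, Matrix.mul_sub, Matrix.sub_mul, Matrix.mul_one, RI_mul, RI_mul, RI_mul, Equiv.symm_trans_self, RI_refl] at h2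
  refine ⟨0, 1, by decide, ?_⟩
  have e3 : Equiv.swap (0 : Fin 5) 1 = e.symm.trans ((Equiv.sumCongr (Equiv.swap 0 1) (Equiv.refl (Fin 3))).trans e) := by
    ext j
    fin_cases j <;> rfl
  rw [e3]
  exact h2

lemma RI_mem (i : ℕ) {B} {w : Equiv.Perm (Fin 5)} {v : Equiv.Perm (Fin 5)}
    (h : 1 - RI K w ∈ MJ ι B (fun _ : Fin 5 => i)) : 1 - RI K (v * w * v⁻¹) ∈ MJ ι B (fun _ : Fin 5 => i) := by
  have h2 := MJ.mul_mul h (RI_hom (ι := ι) v (fun _ => i) (fun _ => i) (by simp))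
    (RI_hom (ι := ι) v⁻¹ (fun _ => i) (fun _ => i) (by simp))
  rw [mul_sub, sub_mul, Matrix.mul_one, RI_mul, RI_mul, RI_mul] at h2
  have e1 : (v⁻¹).trans v = Equiv.refl _ := by ext; simp
  rw [e1, RI_refl] at h2
  exact h2

lemma perm5 (i : ℕ) (w : Equiv.Perm (Fin 5)) : 1 - RI K w ∈ MJ ι 3 (fun _ : Fin 5 => i) := by
  induction w using Equiv.Perm.swap_induction_on with
  | one =>
    have : RI K (1 : Equiv.Perm (Fin 5)) = 1 := RI_refl
    rw [this, sub_self]; exact zero_mem _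
  | swap_mul w a b hab ih =>
    obtain ⟨x, y, hxy, h⟩ := swap5 ι i
    obtain ⟨v, hv⟩ := isConj_iff.1 (Equiv.Perm.isConj_swap hxy hab)
    have h1 := RI_mem ι i (v := v) h
    rw [hv] at h1
    have h2 := MJ.mul_mul ih (RI_hom (ι := ι) (Equiv.swap a b) (fun _ => i) (fun _ => i) (by simp)) MHom.one
    rw [Matrix.mul_one, mul_sub, RI_mul, Matrix.mul_one] at h2
    have := add_mem h1 h2
    rw [sub_add_sub_cancel] at this
    exact this

/-- beta -/
def be (K : Type) [Field K] : Matrix (Fin 3 → Fin 2) (Fin 5 → Fin 2) K :=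
  Matrix.of fun r s => if (r 0).1 + (r 1).1 + 3 * (r 2).1 = ∑ j, (s j).1 then sg K (r 0) (r 1) else 0

lemma fr_succ (i : ℕ) (x : K) : fr (i + 1) x = (fr i x) ^ 3 := by
  simp only [fr, iterateFrobenius_def]
  ring

lemma be_tri (K : Type) [Field K] (a b c : Fin 2) (t : Fin 5 → Fin 2) :
    be K ![a, b, c] t = if a.1 + b.1 + 3 * c.1 = ∑ j, (t j).1 then sg K a b else 0 := rfl

lemma mon_tri (i : ℕ) (A : Matrix (Fin 2) (Fin 2) K) (s : Fin 3 → Fin 2) (t : Fin 3 → Fin 2) :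
    mon ![i, i, i+1] A s t = fr i (A (s 0) (t 0)) * fr i (A (s 1) (t 1)) * fr i (A (s 2) (t 2)) ^ 3 := by
  rw [mon_apply, Fin.prod_univ_three, ← fr_succ]
  rfl

lemma be_hom (i : ℕ) : MHom ι (fun _ : Fin 5 => i) ![i, i, i+1] (be K) := by
  intro g
  ext r t
  have := core (fun a b => fr i (em ι g a b)) (r 0) (r 1) (r 2) t
  rw [Matrix.mul_apply, Matrix.mul_apply, sum_fin3]
  rw [Finset.mul_sum] at this
  trans ∑ s : Fin 5 → Fin 2, sg K (r 0) (r 1) * (if (r 0).1 + (r 1).1 + 3 * (r 2).1 = ∑ j, (s j).1 then ∏ j, fr i (em ι g (s j) (t j)) else 0)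
  · refine Finset.sum_congr rfl fun s _ => ?_
    simp only [be, Matrix.of_apply, mon_apply]
    split_ifs <;> simp
  refine this.trans ?_
  refine Finset.sum_congr rfl fun a _ => Finset.sum_congr rfl fun b _ => Finset.sum_congr rfl fun c _ => ?_
  rw [be_tri, mon_tri]
  show _ = (fr i (em ι g (r 0) a) * fr i (em ι g (r 1) b) * fr i (em ι g (r 2) c) ^ 3) * _
  split_ifs
  · ring
  · rw [mul_zero]

lemma al_hom (i : ℕ) : MHom ι ![i, i, i+1] (fun _ : Fin 5 => i) (be K).transpose := by
  intro g
  ext t r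
  have := core (fun a b => fr i (em ι g b a)) (r 0) (r 1) (r 2) t
  rw [Matrix.mul_apply, Matrix.mul_apply, sum_fin3]
  rw [Finset.mul_sum] at this
  symm
  trans ∑ s : Fin 5 → Fin 2, sg K (r 0) (r 1) * (if (r 0).1 + (r 1).1 + 3 * (r 2).1 = ∑ j, (s j).1 then ∏ j, fr i (em ι g (t j) (s j)) else 0)
  · refine Finset.sum_congr rfl fun s _ => ?_
    simp only [be, Matrix.of_apply, mon_apply, Matrix.transpose_apply]
    split_ifs <;> simp [mul_comm]
  refine this.trans ?_
  refine Finset.sum_congr rfl fun a _ => Finset.sum_congr rfl fun b _ => Finset.sum_congr rfl fun c _ => ?_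
  rw [Matrix.transpose_apply, be_tri, mon_tri]
  show _ = _ * (fr i (em ι g a (r 0)) * fr i (em ι g b (r 1)) * fr i (em ι g c (r 2)) ^ 3)
  split_ifs
  · ring
  · rw [zero_mul]

lemma sg_sq {K : Type} [Field K] (a b : Fin 2) : sg K a b * sg K a b = 1 := by
  unfold sg; split_ifs <;> simp

lemma ab_eq : (be K).transpose * be K = - ∑ a : Fin 4, ∑ b : Fin 5, RI K (aff a b) := by
  ext s t
  have := core3 (K := K) s t
  rw [Matrix.mul_apply, sum_fin3]
  simp only [Matrix.neg_apply, Matrix.sum_apply, RI, Matrix.of_apply]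
  rw [← this]
  refine Finset.sum_congr rfl fun a _ => Finset.sum_congr rfl fun b _ => Finset.sum_congr rfl fun c _ => ?_
  rw [Matrix.transpose_apply, be_tri, be_tri]
  by_cases h1 : a.1 + b.1 + 3 * c.1 = ∑ j, (s j).1 <;> by_cases h2 : a.1 + b.1 + 3 * c.1 = ∑ j, (t j).1
  · rw [if_pos h1, if_pos h2, if_pos ⟨h1, h2⟩]; exact sg_sq _ _
  · rw [if_neg h2, mul_zero, if_neg (fun h => h2 h.2)]
  · rw [if_neg h1, zero_mul, if_neg (fun h => h1 h.1)]
  · rw [if_neg h1, zero_mul, if_neg (fun h => h1 h.1)]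

lemma key5 (i : ℕ) : (1 : Matrix (Fin 5 → Fin 2) (Fin 5 → Fin 2) K) ∈ MJ ι 3 (fun _ : Fin 5 => i) := by
  have h1 : (be K).transpose * be K ∈ MJ ι 3 (fun _ : Fin 5 => i) :=
    AddSubgroup.subset_closure ⟨3, le_rfl, _, _, _, al_hom ι i, be_hom ι i, rfl⟩
  have h2 : ∑ a : Fin 4, ∑ b : Fin 5, (1 - RI K (aff a b)) ∈ MJ ι 3 (fun _ : Fin 5 => i) :=
    sum_mem fun a _ => sum_mem fun b _ => perm5 ι i _
  have h3 := sub_mem h1 h2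
  rw [ab_eq] at h3
  simp only [Finset.sum_sub_distrib] at h3
  have h4 : ∑ a : Fin 4, ∑ b : Fin 5, (1 : Matrix (Fin 5 → Fin 2) (Fin 5 → Fin 2) K) = -1 := by
    have h30 : (3 : K) = 0 := by exact_mod_cast CharP.cast_eq_zero K 3
    simp only [Finset.sum_const, Finset.card_univ, Fintype.card_fin, smul_smul]
    ext s t
    simp only [Matrix.smul_apply, Matrix.neg_apply, nsmul_eq_mul]
    push_cast
    linear_combination 7 * (1 : Matrix (Fin 5 → Fin 2) (Fin 5 → Fin 2) K) s t * h30
  rw [h4] at h3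
  convert h3 using 1
  abel
end
end SLA

end


section
set_option linter.all false
namespace SLA
section
variable {K : Type} [Field K] [CharP K 3] {F : Type} [Field F] [Fintype F] {ι : F →+* K}
variable {n : ℕ} (hF : Fintype.card F = 3 ^ n)
variable {m m' : Type} [Fintype m] [DecidableEq m] [Fintype m'] [DecidableEq m']
include hF

lemma fr_mod (i : ℕ) (x : F) : fr (i % n) (ι x) = fr i (ι x) := by
  have h : ∀ k : ℕ, x ^ (3 ^ (n * k)) = x := by
    intro k
    rw [pow_mul, ← hF]
    exact FiniteField.pow_card_pow k x
  simp only [fr, iterateFrobenius_def, ← map_pow]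
  congr 1
  conv_rhs => rw [← Nat.mod_add_div i n, pow_add, mul_comm, pow_mul, h]

lemma mon_mod (c c' : m → ℕ) (h : ∀ j, c j % n = c' j % n) (g : Matrix.SpecialLinearGroup (Fin 2) F) :
    mon c (em ι g) = mon c' (em ι g) := by
  ext s t
  simp only [mon_apply, em, Matrix.map_apply]
  refine Finset.prod_congr rfl fun j _ => ?_
  rw [← fr_mod hF, h, fr_mod hF]

lemma hom_mod (c c' : m → ℕ) (h : ∀ j, c j % n = c' j % n) : MHom ι c c' 1 := by
  intro g
  rw [mon_mod hF c c' h, Matrix.one_mul, Matrix.mul_one]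

lemma one_mod {B : ℕ} (c c' : m → ℕ) (h : ∀ j, c j % n = c' j % n) (h1 : 1 ∈ MJ ι B c) : 1 ∈ MJ ι B c' := by
  have := MJ.mul_mul h1 (hom_mod hF c c' h) (hom_mod hF c' c (fun j => (h j).symm))
  simpa using this

lemma MJ.trans {B B' : ℕ} {c : m → ℕ} {X} (hX : X ∈ MJ ι B c)
    (h : ∀ r, r ≤ B → ∀ c' : Fin r → ℕ, 1 ∈ MJ ι B' c') : X ∈ MJ ι B' c := by
  refine (AddSubgroup.closure_le _).2 ?_ hX
  rintro x ⟨r, hr, c', Q, P, hQ, hP, rfl⟩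
  have := MJ.mul_mul (h r hr c') hQ hP
  rwa [Matrix.mul_one] at this

lemma step (hn : 1 ≤ n) (c : m → ℕ) (hm : 4 * n < Fintype.card m) : 1 ∈ MJ ι (Fintype.card m - 2) c := by
  classical
  have : NeZero n := ⟨by omega⟩
  obtain ⟨y, hy⟩ := Fintype.exists_lt_card_fiber_of_mul_lt_card (fun j => (⟨c j % n, Nat.mod_lt _ hn⟩ : Fin n))
    (n := 4) (by rw [Fintype.card_fin, mul_comm]; exact hm)
  obtain ⟨T, hT, hT5⟩ := Finset.exists_subset_card_eq (Nat.succ_le_of_lt hy)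
  have e1 : Fin 5 ≃ {x // x ∈ T} := (Fintype.equivFinOfCardEq (by simpa using hT5)).symm
  let e : Fin 5 ⊕ {x // ¬ x ∈ T} ≃ m := (Equiv.sumCongr e1 (Equiv.refl _)).trans (Equiv.sumCompl (· ∈ T))
  have h5 := MJ.ex (ι := ι) (n := {x // ¬ x ∈ T}) (fun _ : Fin 5 => y.1) (fun x => c x.1) (key5 ι y.1)
  rw [ex_one] at h5
  have hc : 3 + Fintype.card {x // ¬ x ∈ T} = Fintype.card m - 2 := by
    have := Fintype.card_congr e
    rw [Fintype.card_sum, Fintype.card_fin] at this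
    omega
  rw [hc] at h5
  refine MJ.of_equiv e (c ∘ e) c (fun _ => rfl) ?_
  refine one_mod hF _ _ ?_ h5
  rintro (j | j)
  · have h2 := (Finset.mem_filter.1 (hT (e1 j).2)).2
    have h3 := congrArg Fin.val h2
    simp only at h3
    show y.1 % n = c (e1 j).1 % n
    rw [h3, Nat.mod_eq_of_lt y.2]
  · rfl

lemma red (hn : 1 ≤ n) : ∀ (N : ℕ) (m : Type) [Fintype m] [DecidableEq m] (c : m → ℕ), Fintype.card m ≤ N → 1 ∈ MJ ι (4 * n) c := by
  intro N
  induction N with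
  | zero =>
    intro m _ _ c hm
    have e := Fintype.equivFin m
    refine MJ.of_equiv e.symm (c ∘ e.symm) c (fun _ => rfl) ?_
    refine AddSubgroup.subset_closure ⟨_, by omega, _, 1, 1, MHom.one, MHom.one, by simp⟩
  | succ N ih =>
    intro m _ _ c hm
    by_cases h : 4 * n < Fintype.card m
    · refine MJ.trans hF (step hF hn c h) ?_
      intro r hr c'
      exact ih _ _ (by rw [Fintype.card_fin]; omega)
    · have e := Fintype.equivFin m
      refine MJ.of_equiv e.symm (c ∘ e.symm) c (fun _ => rfl) ?_
      refine AddSubgroup.subset_closure ⟨_, by omega, _, 1, 1, MHom.one, MHom.one, by simp⟩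

end
end SLA

end


section
set_option linter.all false
namespace SLA
open TensorProduct
section
/-- equivariance -/
def Eqv {k G X Y : Type} [Field k] [Group G] [AddCommGroup X] [Module k X] [AddCommGroup Y] [Module k Y]
  (ρ : Representation k G X) (σ : Representation k G Y) (f : X →ₗ[k] Y) : Prop := ∀ g x, f (ρ g x) = σ g (f x)

variable {k G X Y Z : Type} [Field k] [Group G] [AddCommGroup X] [Module k X] [AddCommGroup Y] [Module k Y]
 [AddCommGroup Z] [Module k Z] {ρ : Representation k G X} {σ : Representation k G Y} {τ : Representation k G Z}

lemma Eqv.comp {f : X →ₗ[k] Y} {h : Y →ₗ[k] Z} (hh : Eqv σ τ h) (hf : Eqv ρ σ f) : Eqv ρ τ (h ∘ₗ f) := by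
  intro g x
  simp [hf g x, hh g]

lemma Eqv.id : Eqv ρ ρ LinearMap.id := fun _ _ => rfl
lemma Eqv.zero : Eqv ρ σ 0 := fun _ _ => by simp
lemma Eqv.add {f f' : X →ₗ[k] Y} (h : Eqv ρ σ f) (h' : Eqv ρ σ f') : Eqv ρ σ (f + f') := by
  intro g x; simp [h g x, h' g x]
lemma Eqv.sub {f f' : X →ₗ[k] Y} (h : Eqv ρ σ f) (h' : Eqv ρ σ f') : Eqv ρ σ (f - f') := by
  intro g x; simp [h g x, h' g x]
lemma Eqv.neg {f : X →ₗ[k] Y} (h : Eqv ρ σ f) : Eqv ρ σ (-f) := by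
  intro g x; simp [h g x]
lemma Eqv.symm {e : X ≃ₗ[k] Y} (h : Eqv ρ σ e.toLinearMap) : Eqv σ ρ e.symm.toLinearMap := by
  intro g x
  apply e.injective
  have := h g (e.symm x)
  simp at this ⊢
  exact this.symm

end

section
variable {K : Type} [Field K] [CharP K 3] {F : Type} [Field F] (ι : F →+* K)
variable {m m' : Type} [Fintype m] [Fintype m'] [DecidableEq m] [DecidableEq m']

/-- monomial representations -/
noncomputable def monRep (c : m → ℕ) : Representation K (Matrix.SpecialLinearGroup (Fin 2) F) ((m → Fin 2) → K) where
  toFun g := Matrix.mulVecLin (mon c (em ι g))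
  map_one' := by
    rw [em_one, mon_one, Matrix.mulVecLin_one]; rfl
  map_mul' g h := by
    rw [em_mul, mon_mul, Matrix.mulVecLin_mul]; rfl

lemma monRep_apply (c : m → ℕ) (g) (v) : monRep ι c g v = (mon c (em ι g)).mulVec v := rfl

lemma MHom.eqv {c : m → ℕ} {c' : m' → ℕ} {P} (h : MHom ι c c' P) :
    Eqv (monRep ι c) (monRep ι c') (Matrix.mulVecLin P) := by
  intro g v
  simp only [monRep_apply, Matrix.mulVecLin_apply, Matrix.mulVec_mulVec, h g]

variable {X Y : Type} [AddCommGroup X] [Module K X] [AddCommGroup Y] [Module K Y]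
  (ρ : Representation K (Matrix.SpecialLinearGroup (Fin 2) F) X)
  (σ : Representation K (Matrix.SpecialLinearGroup (Fin 2) F) Y)

/-- maps factoring through monomials with labels allowed by `p` -/
def MA (p : (r : ℕ) → (Fin r → ℕ) → Prop) : AddSubgroup (X →ₗ[K] X) :=
  AddSubgroup.closure {A | ∃ (r : ℕ) (c : Fin r → ℕ) (_ : p r c) (f : X →ₗ[K] ((Fin r → Fin 2) → K))
    (h : ((Fin r → Fin 2) → K) →ₗ[K] X), Eqv ρ (monRep ι c) f ∧ Eqv (monRep ι c) ρ h ∧ A = h ∘ₗ f}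

variable {ι ρ σ}
variable {p : (r : ℕ) → (Fin r → ℕ) → Prop}

lemma MA.comp {A} (hA : A ∈ MA ι ρ p) {f : Y →ₗ[K] X} {h : X →ₗ[K] Y} (hf : Eqv σ ρ f) (hh : Eqv ρ σ h) :
    h ∘ₗ A ∘ₗ f ∈ MA ι σ p := by
  induction hA using AddSubgroup.closure_induction with
  | mem x hx =>
    obtain ⟨r, c, hp, f', h', h1, h2, rfl⟩ := hx
    exact AddSubgroup.subset_closure ⟨r, c, hp, f' ∘ₗ f, h ∘ₗ h', h1.comp hf, hh.comp h2, rfl⟩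
  | zero => simp
  | add x y _ _ h1 h2 => rw [LinearMap.add_comp, LinearMap.comp_add]; exact add_mem h1 h2
  | neg x _ h1 => rw [LinearMap.neg_comp, LinearMap.comp_neg]; exact neg_mem h1

lemma MA.retract (hA : LinearMap.id ∈ MA ι ρ p) {f : Y →ₗ[K] X} {h : X →ₗ[K] Y} (hf : Eqv σ ρ f) (hh : Eqv ρ σ h)
    (e : h ∘ₗ f = LinearMap.id) : LinearMap.id ∈ MA ι σ p := by
  have := MA.comp hA hf hh
  rwa [LinearMap.id_comp, e] at this

lemma MA.mon (c : m → ℕ) : LinearMap.id ∈ MA ι (monRep ι c) (fun _ _ => True) := by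
  let e := Fintype.equivFin m
  have h1 := (RI_hom (ι := ι) e c (c ∘ e.symm) (by simp)).eqv
  have h2 := (RI_hom (ι := ι) e.symm (c ∘ e.symm) c (by simp)).eqv
  refine AddSubgroup.subset_closure ⟨_, _, trivial, _, _, h1, h2, ?_⟩
  rw [← Matrix.mulVecLin_mul, RI_mul, Equiv.self_trans_symm, RI_refl, Matrix.mulVecLin_one]

/-- tensor of monomials -/
noncomputable def tm (K : Type) [Field K] (m m' : Type) [Fintype m] [Fintype m'] [DecidableEq m] [DecidableEq m'] :
    ((m → Fin 2) → K) ⊗[K] ((m' → Fin 2) → K) →ₗ[K] ((m ⊕ m' → Fin 2) → K) :=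
  TensorProduct.lift (LinearMap.mk₂ K (fun v w s => v (s ∘ Sum.inl) * w (s ∘ Sum.inr))
    (by intros; ext; simp [add_mul]) (by intros; ext; simp [mul_assoc])
    (by intros; ext; simp [mul_add]) (by intros; ext; simp [mul_left_comm]))

lemma tm_apply (v : (m → Fin 2) → K) (w : (m' → Fin 2) → K) (s) :
    tm K m m' (v ⊗ₜ w) s = v (s ∘ Sum.inl) * w (s ∘ Sum.inr) := rfl

/-- inverse -/
noncomputable def tmi (K : Type) [Field K] (m m' : Type) [Fintype m] [Fintype m'] [DecidableEq m] [DecidableEq m'] :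
    ((m ⊕ m' → Fin 2) → K) →ₗ[K] ((m → Fin 2) → K) ⊗[K] ((m' → Fin 2) → K) :=
  (Pi.basisFun K (m ⊕ m' → Fin 2)).constr K (fun s => Pi.single (s ∘ Sum.inl) 1 ⊗ₜ Pi.single (s ∘ Sum.inr) 1)

lemma tmi_single (s) : tmi K m m' (Pi.single s 1) = Pi.single (s ∘ Sum.inl) 1 ⊗ₜ Pi.single (s ∘ Sum.inr) 1 := by
  rw [tmi, ← Pi.basisFun_apply, Module.Basis.constr_basis]

lemma tm_single (a b) : tm K m m' (Pi.single a 1 ⊗ₜ Pi.single b 1) = Pi.single (Sum.elim a b) 1 := by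
  ext s
  obtain ⟨a', b', rfl⟩ := sum_form s
  rw [tm_apply]
  simp only [Sum.elim_comp_inl, Sum.elim_comp_inr, Pi.single_apply]
  by_cases h1 : a' = a <;> by_cases h2 : b' = b <;> simp [h1, h2, Sum.elim_eq_iff]

lemma tmi_tm : tmi K m m' ∘ₗ tm K m m' = LinearMap.id := by
  refine Module.Basis.ext ((Pi.basisFun K _).tensorProduct (Pi.basisFun K _)) ?_
  rintro ⟨a, b⟩
  rw [Module.Basis.tensorProduct_apply, Pi.basisFun_apply, Pi.basisFun_apply, LinearMap.comp_apply, tm_single, tmi_single]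
  simp

lemma tm_tmi : tm K m m' ∘ₗ tmi K m m' = LinearMap.id := by
  refine Module.Basis.ext (Pi.basisFun K _) ?_
  intro s
  rw [Pi.basisFun_apply, LinearMap.comp_apply, tmi_single, tm_single]
  simp

lemma tm_eqv (c : m → ℕ) (c' : m' → ℕ) :
    Eqv ((monRep ι c).tprod (monRep ι c')) (monRep ι (Sum.elim c c')) (tm K m m') := by
  intro g x
  induction x using TensorProduct.induction_on with
  | zero => simp
  | add x y h1 h2 => simp only [map_add, h1, h2]
  | tmul v w =>
    rw [Representation.tprod_apply, TensorProduct.map_tmul]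
    ext s
    obtain ⟨a, b, rfl⟩ := sum_form s
    rw [tm_apply, monRep_apply, monRep_apply, monRep_apply]
    simp only [Sum.elim_comp_inl, Sum.elim_comp_inr, Matrix.mulVec, dotProduct]
    rw [sum_sum, Finset.sum_mul_sum]
    simp only [mon_sum, tm_apply, Sum.elim_comp_inl, Sum.elim_comp_inr]
    refine Finset.sum_congr rfl fun _ _ => Finset.sum_congr rfl fun _ _ => ?_
    ring

lemma tmi_eqv (c : m → ℕ) (c' : m' → ℕ) :
    Eqv (monRep ι (Sum.elim c c')) ((monRep ι c).tprod (monRep ι c')) (tmi K m m') := by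
  let e : _ ≃ₗ[K] _ := LinearEquiv.ofLinear _ _ (tm_tmi (K := K) (m := m) (m' := m')) tmi_tm
  exact Eqv.symm (e := e) (tm_eqv c c')

lemma MA.mon_tensor (c : m → ℕ) (c' : m' → ℕ) :
    LinearMap.id ∈ MA ι ((monRep ι c).tprod (monRep ι c')) (fun _ _ => True) :=
  MA.retract (MA.mon _) (tm_eqv c c') (tmi_eqv c c') tmi_tm

lemma Eqv.tmap {k G X Y X' Y' : Type} [Field k] [Group G] [AddCommGroup X] [Module k X] [AddCommGroup Y] [Module k Y]
  [AddCommGroup X'] [Module k X'] [AddCommGroup Y'] [Module k Y']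
  {ρ : Representation k G X} {σ : Representation k G Y} {ρ' : Representation k G X'} {σ' : Representation k G Y'}
  {f : X →ₗ[k] Y} {f' : X' →ₗ[k] Y'} (hf : Eqv ρ σ f) (hf' : Eqv ρ' σ' f') :
    Eqv (ρ.tprod ρ') (σ.tprod σ') (TensorProduct.map f f') := by
  intro g x
  induction x using TensorProduct.induction_on with
  | zero => simp
  | add x y h1 h2 => simp only [map_add, h1, h2]
  | tmul v w =>
    simp only [Representation.tprod_apply, TensorProduct.map_tmul, hf g, hf' g]

lemma MA.tensor {A B} (hA : A ∈ MA ι ρ (fun _ _ => True)) (hB : B ∈ MA ι σ (fun _ _ => True)) :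
    TensorProduct.map A B ∈ MA ι (ρ.tprod σ) (fun _ _ => True) := by
  induction hA using AddSubgroup.closure_induction with
  | zero => rw [TensorProduct.map_zero_left]; exact zero_mem _
  | add x y _ _ h1 h2 => rw [TensorProduct.map_add_left]; exact add_mem h1 h2
  | neg x _ h1 =>
    have : TensorProduct.map (-x) B = - TensorProduct.map x B := by
      rw [eq_neg_iff_add_eq_zero, ← TensorProduct.map_add_left, neg_add_cancel, TensorProduct.map_zero_left]
    rw [this]; exact neg_mem h1
  | mem x hx =>
    obtain ⟨r, c, -, f, h, h1, h2, rfl⟩ := hx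
    induction hB using AddSubgroup.closure_induction with
    | zero => rw [TensorProduct.map_zero_right]; exact zero_mem _
    | add x y _ _ h1 h2 => rw [TensorProduct.map_add_right]; exact add_mem h1 h2
    | neg x _ h1 =>
      have : TensorProduct.map (h ∘ₗ f) (-x) = - TensorProduct.map (h ∘ₗ f) x := by
        rw [eq_neg_iff_add_eq_zero, ← TensorProduct.map_add_right, neg_add_cancel, TensorProduct.map_zero_right]
      rw [this]; exact neg_mem h1
    | mem x hx =>
      obtain ⟨r', c', -, f', h', h1', h2', rfl⟩ := hx
      rw [TensorProduct.map_comp]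
      have := MA.comp (MA.mon_tensor c c') (h1.tmap h1') (h2.tmap h2')
      rwa [LinearMap.id_comp] at this

lemma MA.bound [Fintype F] {n : ℕ} (hF : Fintype.card F = 3 ^ n) (hn : 1 ≤ n) {A}
    (hA : A ∈ MA ι ρ (fun _ _ => True)) :
    A ∈ MA ι ρ (fun r c => r ≤ 4 * n ∧ ∀ j, c j < n) := by
  refine (AddSubgroup.closure_le _).2 ?_ hA
  rintro _ ⟨r, c, -, f, h, h1, h2, rfl⟩
  have h3 := red (ι := ι) hF hn r (Fin r) c (by simp)
  suffices H : ∀ P ∈ MJ ι (4 * n) c, h ∘ₗ Matrix.mulVecLin P ∘ₗ f ∈ MA ι ρ (fun r c => r ≤ 4 * n ∧ ∀ j, c j < n) by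
    have := H 1 h3
    rwa [Matrix.mulVecLin_one, LinearMap.id_comp] at this
  intro P hP
  induction hP using AddSubgroup.closure_induction with
  | zero => rw [Matrix.mulVecLin_zero, LinearMap.zero_comp, LinearMap.comp_zero]; exact zero_mem _
  | add x y _ _ h1 h2 => rw [Matrix.mulVecLin_add, LinearMap.add_comp, LinearMap.comp_add]; exact add_mem h1 h2
  | neg x _ h1 =>
    have : Matrix.mulVecLin (-x) = - Matrix.mulVecLin x := by
      ext; simp [Matrix.neg_mulVec]
    rw [this, LinearMap.neg_comp, LinearMap.comp_neg]; exact neg_mem h1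
  | mem x hx =>
    obtain ⟨r', hr', c', Q', P', hQ, hP, rfl⟩ := hx
    have e1 := (hom_mod (ι := ι) hF c' (fun j => c' j % n) (by simp)).eqv
    have e2 := (hom_mod (ι := ι) hF (fun j => c' j % n) c' (by simp)).eqv
    refine AddSubgroup.subset_closure ⟨r', fun j => c' j % n, ⟨hr', fun j => Nat.mod_lt _ hn⟩, _, _,
      e1.comp (hP.eqv.comp h1), (h2.comp hQ.eqv).comp e2, ?_⟩
    rw [Matrix.mulVecLin_mul, Matrix.mulVecLin_one]
    rfl

end
end SLA

end


section
set_option linter.all false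
namespace SLA
section

/-- simplicity of a representation -/
def Simp {k G X : Type} [Field k] [Group G] [AddCommGroup X] [Module k X] (ρ : Representation k G X) : Prop :=
  Nontrivial X ∧ ∀ W : Submodule k X, (∀ g, ∀ x ∈ W, ρ g x ∈ W) → W = ⊥ ∨ W = ⊤

lemma perm_two : ∀ a : ℕ, a ≤ 2 → ∀ f f' : Fin a → Fin 2, ∑ x, (f x).1 = ∑ x, (f' x).1 →
    ∃ w : Equiv.Perm (Fin a), f ∘ w = f' := by
  intro a ha
  interval_cases a
  · decide
  · decide
  · decide

variable {K : Type} [Field K] {F : Type} [Field F] [Fintype F] {ι : F →+* K}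

lemma vdm {V : Type} [AddCommGroup V] [Module K V] (N : Submodule K V) {B : ℕ} (hB : B ≤ Fintype.card F) (y : ℕ → V)
    (h : ∀ t : F, ∑ i ∈ Finset.range B, (ι t) ^ i • y i ∈ N) (i : ℕ) (hi : i < B) : y i ∈ N := by
  classical
  rw [← Submodule.Quotient.mk_eq_zero, ← Submodule.mkQ_apply]
  rw [← Module.forall_dual_apply_eq_zero_iff K]
  intro μ
  let p : Polynomial K := ∑ j ∈ Finset.range B, Polynomial.C (μ (N.mkQ (y j))) * Polynomial.X ^ j
  have hd : p.natDegree < Fintype.card F := by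
    refine lt_of_lt_of_le ?_ hB
    have hp : p.degree < B := by
      refine lt_of_le_of_lt (Polynomial.degree_sum_le _ _) ?_
      rw [Finset.sup_lt_iff (by exact WithBot.bot_lt_coe B)]
      intro b hb
      refine lt_of_le_of_lt (Polynomial.degree_C_mul_X_pow_le _ _) ?_
      exact_mod_cast Finset.mem_range.1 hb
    by_cases h0 : p = 0
    · rw [h0]; simp; omega
    · exact (Polynomial.natDegree_lt_iff_degree_lt h0).2 hp
  have h0 : p = 0 := by
    apply Polynomial.eq_zero_of_natDegree_lt_card_of_eval_eq_zero p ι.injective _ hd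
    intro t
    have h1 := (Submodule.Quotient.mk_eq_zero N).2 (h t)
    rw [← Submodule.mkQ_apply] at h1
    have h2 := congrArg μ h1
    simp only [p, Polynomial.eval_finset_sum, Polynomial.eval_mul, Polynomial.eval_C, Polynomial.eval_pow, Polynomial.eval_X]
    simp only [map_sum, map_smul, smul_eq_mul, map_zero] at h2
    rw [← h2]
    exact Finset.sum_congr rfl fun _ _ => mul_comm _ _
  have h3 : p.coeff i = 0 := by rw [h0, Polynomial.coeff_zero]
  simp only [p, Polynomial.finset_sum_coeff, Polynomial.coeff_C_mul_X_pow] at h3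
  rw [Finset.sum_ite_eq, if_pos (Finset.mem_range.2 hi)] at h3
  exact h3

/-- index type of a digit sequence -/
abbrev Ix {n : ℕ} (a : Fin n → Fin 3) : Type := Σ j : Fin n, Fin (a j)

/-- colors -/
def cl {n : ℕ} (a : Fin n → Fin 3) : Ix a → ℕ := fun x => x.1

/-- weight -/
def wgt {n : ℕ} {a : Fin n → Fin 3} (s : Ix a → Fin 2) : ℕ := ∑ x, (s x).1 * 3 ^ (cl a x)
/-- coweight -/
def wgt0 {n : ℕ} {a : Fin n → Fin 3} (s : Ix a → Fin 2) : ℕ := ∑ x, (1 - (s x).1) * 3 ^ (cl a x)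

variable {n : ℕ} {a : Fin n → Fin 3}

lemma wgt_add (s : Ix a → Fin 2) : wgt s + wgt0 s = ∑ j, (a j).1 * 3 ^ j.1 := by
  rw [wgt, wgt0, ← Finset.sum_add_distrib]
  have : ∀ x : Ix a, (s x).1 * 3 ^ (cl a x) + (1 - (s x).1) * 3 ^ (cl a x) = 3 ^ (cl a x) := by
    intro x
    rw [← add_mul]
    have : (s x).1 + (1 - (s x).1) = 1 := by omega
    rw [this, one_mul]
  simp only [this]
  rw [Fintype.sum_sigma]
  simp [cl]

/-- digit of weight -/
def dg (s : Ix a → Fin 2) (j : Fin n) : Fin 3 := ⟨∑ x : Fin (a j), (s ⟨j, x⟩).1, by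
  have : ∑ x : Fin (a j), (s ⟨j, x⟩).1 ≤ ∑ x : Fin (a j), 1 := Finset.sum_le_sum fun x _ => by omega
  simp at this
  omega⟩

lemma dg_le (s : Ix a → Fin 2) (j : Fin n) : (dg s j).1 ≤ (a j).1 := by
  have : ∑ x : Fin (a j), (s ⟨j, x⟩).1 ≤ ∑ x : Fin (a j), 1 := Finset.sum_le_sum fun x _ => by omega
  simp only [Finset.sum_const, Finset.card_univ, Fintype.card_fin, smul_eq_mul, mul_one] at this
  exact this

lemma wgt_eq (s : Ix a → Fin 2) : wgt s = (finFunctionFinEquiv (dg s)).1 := by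
  rw [finFunctionFinEquiv_apply, wgt, Fintype.sum_sigma]
  refine Finset.sum_congr rfl fun j _ => ?_
  simp only [cl, dg, Finset.sum_mul]

lemma dig (b : Fin n → Fin 3) (j : Fin n) : (finFunctionFinEquiv b).1 / 3 ^ j.1 % 3 = (b j).1 := by
  have h : finFunctionFinEquiv.symm (finFunctionFinEquiv b) j = b j := by rw [Equiv.symm_apply_apply]
  exact congrArg Fin.val h

lemma choose_ne [CharP K 3] (s : Ix a → Fin 2) : ((Nat.choose (finFunctionFinEquiv a).1 (wgt s) : ℕ) : K) ≠ 0 := by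
  have hp : Fact (Nat.Prime 3) := ⟨Nat.prime_three⟩
  have h := Choose.choose_modEq_prod_range_choose_nat (p := 3) (n := (finFunctionFinEquiv a).1) (k := wgt s) (a := n)
    (finFunctionFinEquiv a).2 (by rw [wgt_eq]; exact (finFunctionFinEquiv (dg s)).2)
  rw [Ne, CharP.cast_eq_zero_iff K 3, Nat.dvd_iff_mod_eq_zero, h, ← Nat.dvd_iff_mod_eq_zero,
    Prime.dvd_finset_prod_iff Nat.prime_three.prime]
  push Not
  intro i hi
  have := dig a ⟨i, Finset.mem_range.1 hi⟩
  have h2 := dig (dg s) ⟨i, Finset.mem_range.1 hi⟩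
  have h3 := dg_le s ⟨i, Finset.mem_range.1 hi⟩
  rw [wgt_eq]
  simp only at this h2
  rw [this, h2]
  have h4 := (a ⟨i, Finset.mem_range.1 hi⟩).2
  generalize (a ⟨i, Finset.mem_range.1 hi⟩).1 = u at *
  generalize (dg s ⟨i, Finset.mem_range.1 hi⟩).1 = v at *
  interval_cases u <;> interval_cases v <;> decide

/-- color preserving permutations -/
def HH (a : Fin n → Fin 3) : Subgroup (Equiv.Perm (Ix a)) where
  carrier := {w | ∀ x, cl a (w x) = cl a x}
  mul_mem' := by intro u v hu hv x; rw [Equiv.Perm.mul_apply, hu, hv]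
  one_mem' := by intro x; rfl
  inv_mem' := by intro u hu x; have := hu (u⁻¹ x); simpa using this.symm

lemma HH_card [CharP K 3] : ((Nat.card (HH a) : ℕ) : K) ≠ 0 := by
  have hp : Fact (Nat.Prime 3) := ⟨Nat.prime_three⟩
  rw [Ne, CharP.cast_eq_zero_iff K 3]
  intro h
  obtain ⟨w, hw⟩ := exists_prime_orderOf_dvd_card' 3 h
  have key : w ^ 2 = 1 := by
    ext1
    ext1 x
    have h1 := w.2 x
    have h2 := w.2 (w.1 x)
    show w.1 (w.1 x) = x
    by_contra hne
    have hne2 : w.1 x ≠ x := fun h => hne (by rw [h, h])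
    have hne3 : w.1 (w.1 x) ≠ w.1 x := fun h => hne2 (w.1.injective h)
    generalize w.1 (w.1 x) = z at *
    generalize w.1 x = y at *
    obtain ⟨j, x⟩ := x
    obtain ⟨j', y⟩ := y
    obtain ⟨j'', z⟩ := z
    simp only [cl] at h1 h2
    have e1 := Fin.ext h1
    subst e1
    have e2 := Fin.ext h2
    subst e2
    simp only [ne_eq, Sigma.mk.injEq, heq_eq_eq, true_and, not_true] at hne hne2 hne3
    have := (a j'').2
    simp only [Fin.ext_iff] at hne hne2 hne3
    omega
  have := orderOf_dvd_of_pow_eq_one key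
  rw [hw] at this
  norm_num at this

lemma wgt_perm (w : HH a) (s : Ix a → Fin 2) : wgt (s ∘ w.1) = wgt s := by
  rw [wgt, wgt, ← Equiv.sum_comp w.1 (fun x => (s x).1 * 3 ^ (cl a x))]
  refine Finset.sum_congr rfl fun x _ => ?_
  rw [w.2 x]; rfl

lemma wgt_inj {s s' : Ix a → Fin 2} (h : wgt s = wgt s') : ∃ w : HH a, s ∘ w.1 = s' := by
  rw [wgt_eq, wgt_eq] at h
  have h1 := finFunctionFinEquiv.injective (Fin.ext h)
  have h2 : ∀ j, ∃ w : Equiv.Perm (Fin (a j)), (fun x => s ⟨j, x⟩) ∘ w = fun x => s' ⟨j, x⟩ := by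
    intro j
    apply perm_two
    · have := (a j).2; omega
    · exact congrArg Fin.val (congrFun h1 j)
  choose w hw using h2
  refine ⟨⟨Equiv.sigmaCongrRight w, fun x => rfl⟩, ?_⟩
  funext x
  exact congrFun (hw x.1) x.2

end
end SLA

end


section
set_option linter.all false
namespace SLA
section
variable {K : Type} [Field K] [CharP K 3] {F : Type} [Field F] [Fintype F] {ι : F →+* K}
variable {n : ℕ} {a : Fin n → Fin 3}

/-- matrices in SL2 -/
def mk4 {F : Type} [Field F] (a b c d : F) (h : a * d - b * c = 1) : Matrix.SpecialLinearGroup (Fin 2) F :=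
  ⟨!![a, b; c, d], by rw [Matrix.det_fin_two]; exact h⟩

section
variable {F : Type} [Field F] (a b c d : F) (h : a * d - b * c = 1)
lemma mk4_00 : (mk4 a b c d h).1 0 0 = a := rfl
lemma mk4_01 : (mk4 a b c d h).1 0 1 = b := rfl
lemma mk4_10 : (mk4 a b c d h).1 1 0 = c := rfl
lemma mk4_11 : (mk4 a b c d h).1 1 1 = d := rfl
lemma mul_ij (g g' : Matrix.SpecialLinearGroup (Fin 2) F) (i j : Fin 2) :
    (g * g').1 i j = g.1 i 0 * g'.1 0 j + g.1 i 1 * g'.1 1 j := by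
  rw [Matrix.SpecialLinearGroup.coe_mul, Matrix.mul_apply, Fin.sum_univ_two]
lemma sl_ext {g g' : Matrix.SpecialLinearGroup (Fin 2) F} (h0 : g.1 0 0 = g'.1 0 0) (h1 : g.1 0 1 = g'.1 0 1)
   (h2 : g.1 1 0 = g'.1 1 0) (h3 : g.1 1 1 = g'.1 1 1) : g = g' := by
  apply Subtype.ext
  ext i j
  fin_cases i <;> fin_cases j <;> assumption
lemma sl_det (g : Matrix.SpecialLinearGroup (Fin 2) F) : g.1 0 0 * g.1 1 1 - g.1 0 1 * g.1 1 0 = 1 := by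
  rw [← Matrix.det_fin_two]; exact g.2
end

lemma row_eq (g : Matrix.SpecialLinearGroup (Fin 2) F) (s : Ix a → Fin 2) :
    mon (cl a) (em ι g) (fun _ => 1) s = (ι (g.1 1 0)) ^ wgt0 s * (ι (g.1 1 1)) ^ wgt s := by
  rw [mon_apply, wgt0, wgt, ← Finset.prod_pow_eq_pow_sum, ← Finset.prod_pow_eq_pow_sum, ← Finset.prod_mul_distrib]
  refine Finset.prod_congr rfl fun x _ => ?_
  rw [fr, iterateFrobenius_def, em, Matrix.map_apply]
  have : s x = 0 ∨ s x = 1 := by omega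
  rcases this with h | h <;> simp [h]

/-- matrix coefficients -/
noncomputable def Phi (ι : F →+* K) (a : Fin n → Fin 3) : ((Ix a → Fin 2) → K) →ₗ[K] (Matrix.SpecialLinearGroup (Fin 2) F → K) where
  toFun v g := monRep ι (cl a) g v (fun _ => 1)
  map_add' := by intros; ext; simp
  map_smul' := by intros; ext; simp

lemma Phi_apply (v) (g : Matrix.SpecialLinearGroup (Fin 2) F) :
    Phi ι a v g = ∑ s, (ι (g.1 1 0)) ^ wgt0 s * (ι (g.1 1 1)) ^ wgt s * v s := by
  show monRep ι (cl a) g v (fun _ => 1) = _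
  rw [monRep_apply, Matrix.mulVec, dotProduct]
  simp only [row_eq]

lemma wgt0_eq_of {s s' : Ix a → Fin 2} (h : wgt s = wgt s') : wgt0 s = wgt0 s' := by
  have h1 := wgt_add s
  have h2 := wgt_add s'
  omega

/-- symmetrizer -/
noncomputable def Sy (K : Type) [Field K] (a : Fin n → Fin 3) : Matrix (Ix a → Fin 2) (Ix a → Fin 2) K :=
  by classical exact ∑ w : HH a, RI K w.1

lemma Sy_apply (s t) : Sy K a s t = by classical exact ∑ w : HH a, if s ∘ w.1 = t then 1 else 0 := by
  classical
  simp [Sy, Matrix.sum_apply, RI]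

lemma Sy_hom : MHom ι (cl a) (cl a) (Sy K a) := by
  classical
  intro g
  simp only [Sy]
  rw [Finset.sum_mul, Finset.mul_sum]
  exact Finset.sum_congr rfl fun w _ => RI_hom (ι := ι) w.1 _ _ w.2 g

lemma Sy_const (s) {t t' : Ix a → Fin 2} (h : wgt t = wgt t') : Sy K a s t = Sy K a s t' := by
  classical
  obtain ⟨u, rfl⟩ := wgt_inj h
  rw [Sy_apply, Sy_apply, ← Equiv.sum_comp (Equiv.mulRight u) (fun w : HH a => if s ∘ w.1 = t ∘ u.1 then (1 : K) else 0)]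
  refine Finset.sum_congr rfl fun w _ => ?_
  congr 1
  rw [eq_iff_iff]
  constructor
  · rintro rfl; rfl
  · intro h
    funext x
    have := congrFun h (u.1.symm x)
    simpa using this

lemma Phi_Sy (v) : Phi ι a ((Sy K a).mulVec v) = (Nat.card (HH a) : K) • Phi ι a v := by
  classical
  ext g
  rw [Pi.smul_apply, Phi_apply, Phi_apply]
  have h1 : ∀ s, (Sy K a).mulVec v s = ∑ w : HH a, v (s ∘ w.1) := by
    intro s
    simp only [Matrix.mulVec, dotProduct, Sy_apply, Finset.sum_mul, ite_mul, one_mul, zero_mul]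
    rw [Finset.sum_comm]
    simp
  simp only [h1, Finset.mul_sum]
  rw [Finset.sum_comm]
  have h2 : ∀ w : HH a, ∑ s, (ι (g.1 1 0)) ^ wgt0 s * (ι (g.1 1 1)) ^ wgt s * v (s ∘ w.1) =
     ∑ s, (ι (g.1 1 0)) ^ wgt0 s * (ι (g.1 1 1)) ^ wgt s * v s := by
    intro w
    rw [← Equiv.sum_comp (Equiv.arrowCongr w.1.symm (Equiv.refl (Fin 2)))
      (fun s => (ι (g.1 1 0)) ^ wgt0 s * (ι (g.1 1 1)) ^ wgt s * v s)]
    refine Finset.sum_congr rfl fun s _ => ?_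
    have e : (Equiv.arrowCongr w.1.symm (Equiv.refl (Fin 2))) s = s ∘ w.1 := by
      ext x; simp [Equiv.arrowCongr]
    rw [e, wgt_perm, wgt0_eq_of (wgt_perm w s)]
  simp only [h2]
  rw [Finset.sum_const, Finset.card_univ, Nat.card_eq_fintype_card, nsmul_eq_mul, smul_eq_mul, Finset.mul_sum]

lemma wgt_lt (s : Ix a → Fin 2) : wgt s < 3 ^ n := by
  rw [wgt_eq]; exact (finFunctionFinEquiv (dg s)).2

lemma ker_Phi (hF : Fintype.card F = 3 ^ n) {v} (h : Phi ι a v = 0) : (Sy K a).mulVec v = 0 := by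
  classical
  have h1 : ∀ i < 3 ^ n, ∑ s with wgt s = i, v s = 0 := by
    intro i hi
    have := vdm (ι := ι) (⊥ : Submodule K K) hF.ge (fun i => ∑ s : Ix a → Fin 2 with wgt s = i, v s) ?_ i hi
    · exact (Submodule.mem_bot K).1 this
    intro t
    rw [Submodule.mem_bot]
    have h2 := congrFun h (mk4 1 (t-1) 1 t (by ring))
    rw [Phi_apply] at h2
    simp only [mk4_10, mk4_11, map_one, one_pow, one_mul, Pi.zero_apply] at h2
    rw [← h2]
    simp only [smul_eq_mul, Finset.mul_sum]
    rw [← Finset.sum_fiberwise_of_maps_to (t := Finset.range (3 ^ n)) (g := wgt) (s := Finset.univ)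
      (fun s _ => Finset.mem_range.2 (wgt_lt s))]
    refine Finset.sum_congr rfl fun i _ => Finset.sum_congr rfl fun s hs => ?_
    rw [(Finset.mem_filter.1 hs).2]
  ext s
  simp only [Matrix.mulVec, dotProduct, Pi.zero_apply]
  rw [← Finset.sum_fiberwise_of_maps_to (t := Finset.range (3 ^ n)) (g := wgt) (s := Finset.univ)
      (fun s _ => Finset.mem_range.2 (wgt_lt s))]
  refine Finset.sum_eq_zero fun i hi => ?_
  by_cases hne : ∃ t0 : Ix a → Fin 2, wgt t0 = i
  · obtain ⟨t0, rfl⟩ := hne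
    trans ∑ t with wgt t = wgt t0, Sy K a s t0 * v t
    · refine Finset.sum_congr rfl fun t ht => ?_
      rw [Sy_const s (Finset.mem_filter.1 ht).2]
    · rw [← Finset.mul_sum, h1 _ (wgt_lt t0), mul_zero]
  · rw [Finset.filter_eq_empty_iff.2, Finset.sum_empty]
    intro t _ ht
    exact hne ⟨t, ht⟩

variable {X : Type} [AddCommGroup X] [Module K X] {ρ : Representation K (Matrix.SpecialLinearGroup (Fin 2) F) X}

/-- coefficients of X -/
def Lam (ρ : Representation K (Matrix.SpecialLinearGroup (Fin 2) F) X) (l : Module.Dual K X) :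
    X →ₗ[K] (Matrix.SpecialLinearGroup (Fin 2) F → K) where
  toFun x g := l (ρ g x)
  map_add' := by intros; ext; simp
  map_smul' := by intros; ext; simp

lemma cls_A (hF : Fintype.card F = 3 ^ n) (hρ : Simp ρ) (l : Module.Dual K X) (x0 : X) (A : ℕ) (hA : A < 3 ^ n)
    (h : ∀ g, l (ρ g x0) = (ι (g.1 1 0)) ^ A) : LinearMap.id ∈ MA ι ρ (fun _ _ => True) := by
  classical
  set a : Fin n → Fin 3 := finFunctionFinEquiv.symm ⟨A, hA⟩ with ha
  have hAa : (finFunctionFinEquiv a).1 = A := by rw [ha, Equiv.apply_symm_apply]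
  have hAs : ∑ j, (a j).1 * 3 ^ j.1 = A := by rw [← hAa, finFunctionFinEquiv_apply]
  -- injectivity
  have hinj : LinearMap.ker (Lam ρ l) = ⊥ := by
    have hinv : ∀ g, ∀ x ∈ LinearMap.ker (Lam ρ l), ρ g x ∈ LinearMap.ker (Lam ρ l) := by
      intro g x hx
      rw [LinearMap.mem_ker] at hx ⊢
      ext g'
      have : l (ρ (g' * g) x) = 0 := congrFun hx (g' * g)
      rw [map_mul] at this
      exact this
    rcases hρ.2 (LinearMap.ker (Lam ρ l)) hinv with h1 | h1
    · exact h1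
    · exfalso
      have : x0 ∈ LinearMap.ker (Lam ρ l) := by rw [h1]; trivial
      have h2 := congrFun (LinearMap.mem_ker.1 this) (mk4 0 (-1) 1 0 (by ring))
      have h3 : l (ρ _ x0) = 0 := h2
      rw [h] at h3
      simp [mk4_10] at h3
  -- range
  have hmon : ∀ i < A + 1, (fun g : Matrix.SpecialLinearGroup (Fin 2) F =>
      (Nat.choose A i : K) * ((ι (g.1 1 0)) ^ (A - i) * (ι (g.1 1 1)) ^ i)) ∈ LinearMap.range (Lam ρ l) := by
    refine vdm (ι := ι) _ (by omega) _ ?_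
    intro t
    refine ⟨ρ (mk4 1 0 t 1 (by ring)) x0, ?_⟩
    ext g
    show l (ρ g (ρ _ x0)) = _
    rw [← Module.End.mul_apply, ← map_mul, h]
    have : (g * (mk4 1 0 t 1 (by ring)) : Matrix.SpecialLinearGroup (Fin 2) F).1 1 0 = t * g.1 1 1 + g.1 1 0 := by
      rw [mul_ij, mk4_00, mk4_10]; ring
    rw [this, map_add, map_mul, add_pow, Finset.sum_apply]
    refine Finset.sum_congr rfl fun i _ => ?_
    simp only [Pi.smul_apply, smul_eq_mul]
    ring
  have hsingle : ∀ s, Phi ι a (Pi.single s 1) ∈ LinearMap.range (Lam ρ l) := by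
    intro s
    have h1 := wgt_add s
    have h2 := hmon (wgt s) (by omega)
    have h3 := choose_ne (K := K) s
    rw [hAa] at h3
    convert (LinearMap.range (Lam ρ l)).smul_mem ((Nat.choose A (wgt s) : K)⁻¹) h2 using 1
    ext g
    rw [Phi_apply, Pi.smul_apply, smul_eq_mul, inv_mul_cancel_left₀ h3]
    have : wgt0 s = A - wgt s := by omega
    rw [Finset.sum_eq_single s]
    · simp [this]
    · intro b _ hb; simp [Pi.single_apply, hb]
    · simp
  have hrange : ∀ v, Phi ι a v ∈ LinearMap.range (Lam ρ l) := by
    intro v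
    have : v = ∑ s, v s • (Pi.single s 1 : (Ix a → Fin 2) → K) := by
      ext t; simp [Finset.sum_apply, Pi.single_apply]
    rw [this, map_sum]
    refine Submodule.sum_mem _ fun s _ => ?_
    rw [map_smul]
    exact Submodule.smul_mem _ _ (hsingle s)
  obtain ⟨Li, hLi⟩ := LinearMap.exists_leftInverse_of_injective _ hinj
  let P : ((Ix a → Fin 2) → K) →ₗ[K] X := Li ∘ₗ Phi ι a
  have hLP : ∀ v, Lam ρ l (P v) = Phi ι a v := by
    intro v
    obtain ⟨x, hx⟩ := hrange v
    show Lam ρ l (Li (Phi ι a v)) = _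
    rw [← hx]
    congr 1
    exact LinearMap.congr_fun hLi x
  have hLinj := LinearMap.ker_eq_bot.1 hinj
  have hPe : Eqv (monRep ι (cl a)) ρ P := by
    intro g v
    apply hLinj
    rw [hLP]
    ext g'
    show monRep ι (cl a) g' (monRep ι (cl a) g v) _ = l (ρ g' (ρ g _))
    rw [← Module.End.mul_apply, ← Module.End.mul_apply, ← map_mul, ← map_mul]
    exact (congrFun (hLP v) (g' * g)).symm
  have hsurj : LinearMap.range P = ⊤ := by
    have hinv : ∀ g, ∀ x ∈ LinearMap.range P, ρ g x ∈ LinearMap.range P := by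
      rintro g _ ⟨v, rfl⟩
      exact ⟨monRep ι (cl a) g v, hPe g v⟩
    rcases hρ.2 (LinearMap.range P) hinv with h1 | h1
    · exfalso
      have h2 : P (Pi.single (fun _ => 0) 1) = 0 := by
        have : P (Pi.single (fun _ => 0) 1) ∈ LinearMap.range P := ⟨_, rfl⟩
        rw [h1] at this
        exact this
      have h3 := hLP (Pi.single (fun _ => 0) 1)
      rw [h2, map_zero] at h3
      have h4 := congrFun h3 (mk4 0 (-1) 1 0 (by ring))
      rw [Phi_apply, Finset.sum_eq_single (fun _ => 0)] at h4
      · simp [wgt, mk4_10, Pi.single_apply] at h4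
      · intro b _ hb; simp [Pi.single_apply, hb]
      · simp
    · exact h1
  obtain ⟨R, hR⟩ := LinearMap.exists_rightInverse_of_surjective P hsurj
  have hR' : ∀ x, P (R x) = x := fun x => LinearMap.congr_fun hR x
  let Q : X →ₗ[K] ((Ix a → Fin 2) → K) := (Nat.card (HH a) : K)⁻¹ • (Matrix.mulVecLin (Sy K a) ∘ₗ R)
  have hQP : ∀ v, Q (P v) = (Nat.card (HH a) : K)⁻¹ • (Sy K a).mulVec v := by
    intro v
    show (Nat.card (HH a) : K)⁻¹ • ((Sy K a).mulVec (R (P v))) = _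
    congr 1
    rw [← sub_eq_zero, ← Matrix.mulVec_sub]
    apply ker_Phi (ι := ι) hF
    rw [← hLP, map_sub, hR', sub_self, map_zero]
  refine MA.retract (MA.mon (ι := ι) (cl a)) (f := Q) (h := P) ?_ hPe ?_
  · intro g x
    obtain ⟨v, rfl⟩ := LinearMap.range_eq_top.1 hsurj x
    rw [← hPe, hQP, hQP, map_smul]
    congr 1
    exact (Sy_hom (ι := ι)).eqv ι g v
  · ext x
    obtain ⟨v, rfl⟩ := LinearMap.range_eq_top.1 hsurj x
    show P (Q (P v)) = P v
    rw [hQP, map_smul]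
    apply hLinj
    rw [map_smul, hLP, hLP, Phi_Sy, smul_smul, inv_mul_cancel₀ HH_card, one_smul]
end
end SLA

end


section
set_option linter.all false
namespace SLA
section
variable {K : Type} [Field K] [CharP K 3] {F : Type} [Field F] [Fintype F] {ι : F →+* K}
variable {X : Type} [AddCommGroup X] [Module K X] {ρ : Representation K (Matrix.SpecialLinearGroup (Fin 2) F) X}

lemma killed (L : List (Module.End K X)) (hc : ∀ A ∈ L, ∀ B ∈ L, A * B = B * A) (h3 : ∀ A ∈ L, A ^ 3 = 0)
    (x : X) (hx : x ≠ 0) : ∃ y : X, y ≠ 0 ∧ ∀ A ∈ L, A y = 0 := by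
  induction L with
  | nil => exact ⟨x, hx, by simp⟩
  | cons A L ih =>
    obtain ⟨y, hy, hL⟩ := ih (fun A hA B hB => hc A (by simp [hA]) B (by simp [hB])) (fun A hA => h3 A (by simp [hA]))
    have hA3 := LinearMap.congr_fun (h3 A (by simp)) y
    rw [pow_succ, pow_two] at hA3
    have hA3 : A (A (A y)) = 0 := hA3
    have hcm : ∀ z, (∀ B ∈ L, B z = 0) → ∀ B ∈ L, B (A z) = 0 := by
      intro z hz B hB
      have := LinearMap.congr_fun (hc A (by simp) B (by simp [hB])) z
      have : A (B z) = B (A z) := this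
      rw [← this, hz B hB, map_zero]
    by_cases h1 : A y = 0
    · exact ⟨y, hy, by simpa [h1] using hL⟩
    by_cases h2 : A (A y) = 0
    · exact ⟨A y, h1, by simpa [h2] using hcm _ hL⟩
    · exact ⟨A (A y), h2, by simpa [hA3] using hcm _ (hcm _ hL)⟩

/-- unipotents -/
def uu (t : F) : Matrix.SpecialLinearGroup (Fin 2) F := mk4 1 t 0 1 (by ring)
/-- torus -/
def dd (t : Fˣ) : Matrix.SpecialLinearGroup (Fin 2) F := mk4 (t : F) 0 0 ((t⁻¹ : Fˣ) : F) (by simp)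
/-- Weyl element -/
def ww (F : Type) [Field F] : Matrix.SpecialLinearGroup (Fin 2) F := mk4 0 (-1) 1 0 (by ring)

lemma uu_mul (s t : F) : uu s * uu t = uu (s + t) := by
  apply sl_ext <;> simp only [uu, mul_ij, mk4_00, mk4_01, mk4_10, mk4_11] <;> ring
lemma dd_mul (s t : Fˣ) : dd s * dd t = dd (s * t) := by
  apply sl_ext <;> simp only [dd, mul_ij, mk4_00, mk4_01, mk4_10, mk4_11] <;> simp [mul_comm]
lemma uu_dd (s : F) (t : Fˣ) : uu s * dd t = dd t * uu (s * (t⁻¹ : Fˣ) * (t⁻¹ : Fˣ)) := by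
  apply sl_ext <;> simp only [dd, uu, mul_ij, mk4_00, mk4_01, mk4_10, mk4_11] <;> simp
  field_simp
lemma uu_zero : uu (0 : F) = 1 := by
  apply sl_ext <;> simp only [uu, mk4_00, mk4_01, mk4_10, mk4_11] <;> simp
lemma dd_one : dd (1 : Fˣ) = 1 := by
  apply sl_ext <;> simp only [dd, mk4_00, mk4_01, mk4_10, mk4_11] <;> simp

lemma fixed [CharP F 3] [Nontrivial X] (ρ : Representation K (Matrix.SpecialLinearGroup (Fin 2) F) X) :
    ∃ y : X, y ≠ 0 ∧ ∀ t : F, ρ (uu t) y = y := by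
  classical
  obtain ⟨x, hx⟩ := exists_ne (0 : X)
  have hcomm : ∀ s t : F, ρ (uu s) * ρ (uu t) = ρ (uu t) * ρ (uu s) := by
    intro s t; rw [← map_mul, ← map_mul, uu_mul, uu_mul, add_comm]
  suffices H : _ ∧ _ by
    obtain ⟨y, hy, h⟩ := killed ((Finset.univ : Finset F).toList.map (fun t => ρ (uu t) - 1)) H.1 H.2 x hx
    refine ⟨y, hy, fun t => ?_⟩
    have := h (ρ (uu t) - 1) (List.mem_map.2 ⟨t, by simp, rfl⟩)
    exact sub_eq_zero.1 this
  constructor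
  · simp only [List.mem_map]
    rintro _ ⟨s, -, rfl⟩ _ ⟨t, -, rfl⟩
    have := hcomm s t
    simp only [sub_mul, mul_sub, this, mul_one, one_mul]
    abel
  · simp only [List.mem_map]
    rintro _ ⟨t, -, rfl⟩
    have h3 : (ρ (uu t)) ^ 3 = 1 := by
      rw [← map_pow, pow_succ, pow_two, uu_mul, uu_mul]
      have : t + t + t = 0 := by
        have : (3 : F) = 0 := by exact_mod_cast CharP.cast_eq_zero F 3
        linear_combination t * this
      rw [this, uu_zero, map_one]
    have h30 : ∀ A : Module.End K X, A + A + A = 0 := by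
      intro A
      have : (3 : K) = 0 := by exact_mod_cast CharP.cast_eq_zero K 3
      have h : (3 : K) • A = 0 := by rw [this, zero_smul]
      rw [← h, show (3 : K) = 1 + 1 + 1 by norm_num, add_smul, add_smul, one_smul]
    have h2 := h30 (ρ (uu t))
    have h4 := h30 (ρ (uu t) * ρ (uu t))
    calc (ρ (uu t) - 1) ^ 3 = ρ (uu t) ^ 3 - 1 - (ρ (uu t) * ρ (uu t) + ρ (uu t) * ρ (uu t) + ρ (uu t) * ρ (uu t)) + (ρ (uu t) + ρ (uu t) + ρ (uu t)) := by noncomm_ring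
      _ = 0 := by rw [h3, h2, h4]; simp

lemma units_pow (x : Fˣ) : x ^ (Fintype.card F - 1) = 1 := by
  classical
  rw [← Fintype.card_units]; exact pow_card_eq_one

lemma geom_zero (x : Fˣ) (hx : x ≠ 1) : ∑ j ∈ Finset.range (Fintype.card F - 1), ι (x : F) ^ j = 0 := by
  have h1 := mul_geom_sum (ι (x : F)) (Fintype.card F - 1)
  have h2 : ι (x : F) ^ (Fintype.card F - 1) = 1 := by
    rw [← map_pow, ← Units.val_pow_eq_pow_val, units_pow]; simp
  rw [h2, sub_self] at h1
  rcases mul_eq_zero.1 h1 with h | h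
  · exfalso; apply hx
    ext
    apply ι.injective
    rw [sub_eq_zero.1 h]; simp
  · exact h

lemma card_cast {n : ℕ} (hn : 1 ≤ n) (hF : Fintype.card F = 3 ^ n) : ((Fintype.card F : ℕ) : K) = 0 := by
  rw [hF, Nat.cast_pow]
  have : ((3 : ℕ) : K) = 0 := CharP.cast_eq_zero K 3
  rw [this, zero_pow (by omega)]

lemma weight {n : ℕ} (hn : 1 ≤ n) (hF : Fintype.card F = 3 ^ n) [CharP F 3] [Nontrivial X] (ι : F →+* K)
    (ρ : Representation K (Matrix.SpecialLinearGroup (Fin 2) F) X) :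
    ∃ (y : X) (j : ℕ), j < Fintype.card F - 1 ∧ y ≠ 0 ∧ (∀ t : F, ρ (uu t) y = y) ∧
      ∀ t : Fˣ, ρ (dd t) y = ι (t : F) ^ j • y := by
  classical
  obtain ⟨m0, h0, hm0⟩ := fixed ρ
  let mj : ℕ → X := fun j => ∑ t : Fˣ, ι ((t⁻¹ : Fˣ) : F) ^ j • ρ (dd t) m0
  have hsum : ∑ j ∈ Finset.range (Fintype.card F - 1), mj j = - m0 := by
    simp only [mj]
    rw [Finset.sum_comm]
    simp only [← Finset.sum_smul]
    rw [Finset.sum_eq_single 1]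
    · simp only [inv_one, Units.val_one, map_one, one_pow, Finset.sum_const, Finset.card_range, dd_one]
      have h1 : 1 ≤ Fintype.card F := Fintype.card_pos
      rw [nsmul_eq_mul, mul_one, Nat.cast_sub h1, card_cast hn hF]
      simp
    · intro t _ ht
      rw [geom_zero _ (by simpa using ht), zero_smul]
    · simp
  obtain ⟨j, hj, hne⟩ : ∃ j ∈ Finset.range (Fintype.card F - 1), mj j ≠ 0 := by
    by_contra hcon
    push Not at hcon
    rw [Finset.sum_eq_zero hcon] at hsum
    exact h0 (neg_eq_zero.1 hsum.symm)
  refine ⟨mj j, j, Finset.mem_range.1 hj, hne, ?_, ?_⟩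
  · intro s
    simp only [mj, map_sum, map_smul]
    refine Finset.sum_congr rfl fun t _ => ?_
    rw [← Module.End.mul_apply, ← map_mul, uu_dd, map_mul, Module.End.mul_apply, hm0]
  · intro s
    simp only [mj, map_sum, map_smul, Finset.smul_sum]
    rw [← Equiv.sum_comp (Equiv.mulLeft s) (fun t : Fˣ => ι (s : F) ^ j • ι ((t⁻¹ : Fˣ) : F) ^ j • ρ (dd t) m0)]
    refine Finset.sum_congr rfl fun t _ => ?_
    rw [← Module.End.mul_apply, ← map_mul, dd_mul, smul_smul, ← mul_pow, ← map_mul, Equiv.coe_mulLeft]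
    congr 3
    simp
    have := s.ne_zero
    have := t.ne_zero
    field_simp

lemma S_pos {j : ℕ} (hj : j < Fintype.card F - 1) : ∑ t : F, ι t ^ j = 0 := by
  have h := FiniteField.sum_pow_lt_card_sub_one F j hj
  have := congrArg ι h
  simpa [map_sum, map_pow] using this

theorem cls {n : ℕ} (hn : 1 ≤ n) (hF : Fintype.card F = 3 ^ n) (hρ : Simp ρ) :
    LinearMap.id ∈ MA ι ρ (fun _ _ => True) := by
  classical
  haveI : CharP F 3 := (RingHom.charP_iff ι ι.injective 3).2 inferInstance
  haveI := hρ.1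
  haveI : Nontrivial (Module.Dual K X) := by
    obtain ⟨x, hx⟩ := exists_ne (0 : X)
    by_contra hcon
    rw [not_nontrivial_iff_subsingleton] at hcon
    apply hx
    rw [← Module.forall_dual_apply_eq_zero_iff K]
    intro f
    rw [Subsingleton.elim f 0]; rfl
  obtain ⟨l, hl0, hl'⟩ := fixed ρ.dual
  have hl : ∀ t x, l (ρ (uu t) x) = l x := by
    intro t x
    conv_lhs => rw [← hl' t]
    show l (ρ (uu t)⁻¹ (ρ (uu t) x)) = _
    rw [← Module.End.mul_apply, ← map_mul]; simp
  obtain ⟨m, j, hj, hm0, hmu, hmd⟩ := weight hn hF ι ρ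
  have f1 : ∀ g : Matrix.SpecialLinearGroup (Fin 2) F, g.1 1 0 ≠ 0 → l (ρ g m) = ι (g.1 1 0) ^ j * l (ρ (ww F) m) := by
    intro g hg
    have hd := sl_det g
    have : g = uu (g.1 0 0 / g.1 1 0) * (ww F * (dd (Units.mk0 _ hg) * uu (g.1 1 1 / g.1 1 0))) := by
      apply sl_ext <;> simp only [dd, uu, ww, mul_ij, mk4_00, mk4_01, mk4_10, mk4_11] <;> simp <;> field_simp
      linear_combination (- 1 : F) * hd
    conv_lhs => rw [this, map_mul, map_mul, map_mul]
    simp only [Module.End.mul_apply]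
    rw [hl, hmu, hmd, map_smul, map_smul]; rfl
  have f0 : ∀ g : Matrix.SpecialLinearGroup (Fin 2) F, g.1 1 0 = 0 → l (ρ g m) = ι (g.1 0 0) ^ j * l m := by
    intro g hg
    have hd := sl_det g
    rw [hg, mul_zero, sub_zero] at hd
    have ha : g.1 0 0 ≠ 0 := left_ne_zero_of_mul_eq_one hd
    have : g = uu (g.1 0 0 * g.1 0 1) * dd (Units.mk0 _ ha) := by
      apply sl_ext <;> simp only [dd, uu, mul_ij, mk4_00, mk4_01, mk4_10, mk4_11] <;> simp
      · field_simp
      · exact hg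
      · exact eq_inv_of_mul_eq_one_right hd
    conv_lhs => rw [this, map_mul]
    simp only [Module.End.mul_apply]
    rw [hl, hmd, map_smul]; rfl
  set φ := l (ρ (ww F) m) with hφ
  set h := l m with hh
  have hq : Fintype.card F - 1 < 3 ^ n := by rw [← hF]; have := Fintype.card_pos (α := F); omega
  have hq1 : 1 < Fintype.card F := Fintype.one_lt_card
  have hιpow : ∀ c : F, c ≠ 0 → ι c ^ (Fintype.card F - 1) = 1 := by
    intro c hc
    rw [← map_pow, FiniteField.pow_card_sub_one_eq_one c hc, map_one]
  by_cases hz : h = 0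
  · have hφ0 : φ ≠ 0 := by
      intro hφ0
      let W : Submodule K X := LinearMap.ker (Lam ρ l)
      have hinv : ∀ g, ∀ x ∈ W, ρ g x ∈ W := by
        intro g x hx
        rw [LinearMap.mem_ker] at hx ⊢
        ext g'
        have : l (ρ (g' * g) x) = 0 := congrFun hx (g' * g)
        rw [map_mul] at this
        exact this
      have hmW : m ∈ W := by
        rw [LinearMap.mem_ker]
        ext g
        show l (ρ g m) = 0
        by_cases hg : g.1 1 0 = 0
        · rw [f0 g hg, hz, mul_zero]
        · rw [f1 g hg, hφ0, mul_zero]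
      rcases hρ.2 W hinv with h1 | h1
      · rw [h1, Submodule.mem_bot K] at hmW; exact hm0 hmW
      · apply hl0
        ext x
        have : x ∈ W := by rw [h1]; trivial
        have := congrFun (LinearMap.mem_ker.1 this) 1
        have h2 : l (ρ 1 x) = 0 := this
        rw [map_one] at h2
        exact h2
    refine cls_A (ι := ι) hF hρ l (φ⁻¹ • m) (if j = 0 then Fintype.card F - 1 else j) (by split_ifs <;> omega) ?_
    intro g
    rw [map_smul, map_smul, smul_eq_mul]
    by_cases hg : g.1 1 0 = 0
    · rw [f0 g hg, hz, hg, map_zero, zero_pow (by split_ifs <;> omega)]; simp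
    · rw [f1 g hg]
      split_ifs with h0
      · rw [hιpow _ hg, h0]; simp [hφ0]
      · field_simp
  · by_cases hj0 : j = 0 ∧ h = φ
    · obtain ⟨rfl, hhφ⟩ := hj0
      refine cls_A (ι := ι) hF hρ l (h⁻¹ • m) 0 (by positivity) ?_
      intro g
      rw [map_smul, map_smul, smul_eq_mul]
      by_cases hg : g.1 1 0 = 0
      · rw [f0 g hg]; simp [hz]
      · rw [f1 g hg, ← hhφ]; simp [hz]
    · let m' : X := ∑ t : F, ρ (uu t * ww F) m
      have e10 : ∀ (g : Matrix.SpecialLinearGroup (Fin 2) F) t, (g * (uu t * ww F)).1 1 0 = g.1 1 0 * t + g.1 1 1 := by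
        intro g t
        simp only [uu, ww, mul_ij, mk4_00, mk4_01, mk4_10, mk4_11]; ring
      have e00 : ∀ (g : Matrix.SpecialLinearGroup (Fin 2) F) t, (g * (uu t * ww F)).1 0 0 = g.1 0 0 * t + g.1 0 1 := by
        intro g t
        simp only [uu, ww, mul_ij, mk4_00, mk4_01, mk4_10, mk4_11]; ring
      have hm' : ∀ g, l (ρ g m') = ∑ t : F, l (ρ (g * (uu t * ww F)) m) := by
        intro g
        simp only [m', map_sum]
        refine Finset.sum_congr rfl fun t _ => ?_
        rw [map_mul ρ g]; rfl
      have hm0' : ∀ g : Matrix.SpecialLinearGroup (Fin 2) F, g.1 1 0 = 0 → l (ρ g m') = 0 := by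
        intro g hg
        have hd := sl_det g
        rw [hg, mul_zero, sub_zero] at hd
        have ha : g.1 1 1 ≠ 0 := right_ne_zero_of_mul_eq_one hd
        rw [hm']
        have : ∀ t : F, l (ρ (g * (uu t * ww F)) m) = ι (g.1 1 1) ^ j * φ := by
          intro t
          have e : (g * (uu t * ww F)).1 1 0 = g.1 1 1 := by rw [e10, hg]; ring
          rw [f1 _ (by rw [e]; exact ha), e]
        simp only [this]
        rw [Finset.sum_const, Finset.card_univ, nsmul_eq_mul, card_cast hn hF, zero_mul]
      have hm1' : ∀ g : Matrix.SpecialLinearGroup (Fin 2) F, g.1 1 0 ≠ 0 →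
          l (ρ g m') = (∑ y : F, if y = 0 then 0 else ι y ^ j * φ) + ι (- (g.1 1 0)⁻¹) ^ j * h := by
        intro g hg
        have hd := sl_det g
        rw [hm']
        have hb : Function.Bijective (fun t : F => g.1 1 0 * t + g.1 1 1) := by
          rw [Fintype.bijective_iff_injective_and_card]
          refine ⟨?_, rfl⟩
          intro s t hst
          exact mul_left_cancel₀ hg (add_right_cancel hst)
        rw [← Function.Bijective.sum_comp hb (fun y => if y = 0 then 0 else ι y ^ j * φ)]
        have h2 : ι (- (g.1 1 0)⁻¹) ^ j * h = ∑ t : F, if t = - g.1 1 1 / g.1 1 0 then ι (- (g.1 1 0)⁻¹) ^ j * h else 0 := by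
          simp
        rw [h2, ← Finset.sum_add_distrib]
        refine Finset.sum_congr rfl fun t _ => ?_
        by_cases ht : g.1 1 0 * t + g.1 1 1 = 0
        · have ht' : t = - g.1 1 1 / g.1 1 0 := by
            rw [eq_div_iff hg]; linear_combination ht
          rw [if_pos ht, if_pos ht', zero_add, f0 _ (by rw [e10]; exact ht), e00]
          congr 3
          rw [ht']
          field_simp
          linear_combination (-1 : F) * hd
        · have ht' : t ≠ - g.1 1 1 / g.1 1 0 := by
            intro hc; apply ht; rw [hc]; field_simp; ring
          rw [if_neg ht, if_neg ht', add_zero, f1 _ (by rw [e10]; exact ht), e10]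
      have hS : (∑ y : F, if y = 0 then 0 else ι y ^ j * φ) = if j = 0 then - φ else 0 := by
        have h3 : ∀ y : F, (if y = 0 then 0 else ι y ^ j * φ) = ι y ^ j * φ - if y = 0 then 0 ^ j * φ else 0 := by
          intro y
          split_ifs with hy
          · rw [hy, map_zero, sub_self]
          · rw [sub_zero]
        simp only [h3]
        rw [Finset.sum_sub_distrib, ← Finset.sum_mul, S_pos hj]
        by_cases h0 : j = 0
        · simp [h0]
        · simp [h0]
      let cst : K := if j = 0 then h - φ else (-1) ^ j * h
      have hcst : cst ≠ 0 := by
        simp only [cst]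
        split_ifs with h0
        · rw [sub_ne_zero]; exact fun h => hj0 ⟨h0, h⟩
        · exact mul_ne_zero (pow_ne_zero _ (by simp)) hz
      refine cls_A (ι := ι) hF hρ l (cst⁻¹ • m') (Fintype.card F - 1 - j) (by omega) ?_
      intro g
      rw [map_smul, map_smul, smul_eq_mul]
      by_cases hg : g.1 1 0 = 0
      · rw [hm0' g hg, hg, map_zero, zero_pow (by omega), mul_zero]
      · rw [hm1' g hg, hS, inv_mul_eq_iff_eq_mul₀ hcst]
        have hιg : ι (g.1 1 0) ≠ 0 := by rwa [map_ne_zero]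
        have hp : ι (g.1 1 0) ^ (Fintype.card F - 1 - j) * ι (g.1 1 0) ^ j = 1 := by
          rw [← pow_add, Nat.sub_add_cancel (by omega), hιpow _ hg]
        have hp' : ι (g.1 1 0) ^ (Fintype.card F - 1 - j) = (ι (g.1 1 0) ^ j)⁻¹ := eq_inv_of_mul_eq_one_left hp
        rw [hp']
        simp only [cst]
        split_ifs with h0
        · subst h0; simp; ring
        · rw [map_neg, map_inv₀, neg_pow, inv_pow]; ring
end
end SLA

end


section
set_option linter.all false
namespace SLA
open TensorProduct
section
variable {k K G X Y : Type} [Field k] [Field K] [Algebra k K] [Group G] [AddCommGroup X] [Module k X] [AddCommGroup Y] [Module k Y]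
 {ρ : Representation k G X} {σ : Representation k G Y}

/-- base change -/
noncomputable def bc (K : Type) [Field K] [Algebra k K] (ρ : Representation k G X) : Representation K G (K ⊗[k] X) where
  toFun g := (ρ g).baseChange K
  map_one' := by rw [map_one]; exact LinearMap.baseChange_id
  map_mul' g h := by rw [map_mul]; exact LinearMap.baseChange_comp _ _

lemma bc_tmul (g : G) (c : K) (x : X) : bc K ρ g (c ⊗ₜ x) = c ⊗ₜ ρ g x := rfl

lemma Eqv.bc {f : X →ₗ[k] Y} (hf : Eqv ρ σ f) : Eqv (bc K ρ) (bc K σ) (f.baseChange K) := by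
  intro g x
  induction x using TensorProduct.induction_on with
  | zero => simp
  | add x y h1 h2 => simp only [map_add, h1, h2]
  | tmul c x => rw [bc_tmul, LinearMap.baseChange_tmul, LinearMap.baseChange_tmul, bc_tmul, hf g x]

/-- distributing base change -/
noncomputable def dbc (k K X Y : Type) [Field k] [Field K] [Algebra k K] [AddCommGroup X] [Module k X] [AddCommGroup Y] [Module k Y] :
    K ⊗[k] (X ⊗[k] Y) ≃ₗ[K] (K ⊗[k] X) ⊗[K] (K ⊗[k] Y) := TensorProduct.AlgebraTensorModule.distribBaseChange k K X Y

lemma dbc_tmul (c : K) (x : X) (y : Y) : dbc k K X Y (c ⊗ₜ (x ⊗ₜ y)) = (c ⊗ₜ x) ⊗ₜ (1 ⊗ₜ y) := by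
  simp [dbc]

lemma bc_tensor : Eqv (X := K ⊗[k] (X ⊗[k] Y)) (Y := (K ⊗[k] X) ⊗[K] (K ⊗[k] Y)) (bc K (ρ.tprod σ)) ((bc K ρ).tprod (bc K σ))
    (dbc k K X Y).toLinearMap := by
  intro g x
  induction x using TensorProduct.induction_on with
  | zero => simp
  | add x y h1 h2 => simp only [map_add, h1, h2]
  | tmul c z =>
    induction z using TensorProduct.induction_on with
    | zero => simp
    | add x y h1 h2 => simp only [tmul_add, map_add, h1, h2]
    | tmul x y =>
      rw [bc_tmul, Representation.tprod_apply, TensorProduct.map_tmul, LinearEquiv.coe_coe, dbc_tmul, dbc_tmul,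
        Representation.tprod_apply, TensorProduct.map_tmul, bc_tmul, bc_tmul]

open scoped MonoidAlgebra in
lemma simple_mod (hρ : Simp ρ) : IsSimpleModule k[G] ρ.asModule := by
  rw [← Representation.irreducible_iff_isSimpleModule_asModule]
  haveI := hρ.1
  refine { exists_pair_ne := ⟨⊥, ⊤, ?_⟩, eq_bot_or_eq_top := ?_ }
  · intro h
    have := congrArg Subrepresentation.toSubmodule h
    exact bot_ne_top this
  · intro W
    rcases hρ.2 W.toSubmodule (fun g x hx => W.apply_mem_toSubmodule g hx) with h | h
    · left; exact Subrepresentation.toSubmodule_injective h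
    · right; exact Subrepresentation.toSubmodule_injective h

open scoped MonoidAlgebra in
lemma ksplit (B : Type) (hρ : Simp ρ) (W : Submodule k (B →₀ X)) (hW : ∀ g, ∀ v ∈ W, Finsupp.mapRange.linearMap (ρ g) v ∈ W) :
    ∃ p : (B →₀ X) →ₗ[k] (B →₀ X), (∀ g v, p (Finsupp.mapRange.linearMap (ρ g) v) = Finsupp.mapRange.linearMap (ρ g) (p v)) ∧
      (∀ v, p v ∈ W) ∧ ∀ v ∈ W, p v = v := by
  haveI := simple_mod hρ
  have hs : ∀ (g : G) (r : k) (v : B →₀ ρ.asModule), (MonoidAlgebra.single g r : k[G]) • v = (r • Finsupp.mapRange.linearMap (ρ g) (v : B →₀ X) : B →₀ X) := by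
    intro g r v
    ext b
    exact Representation.single_smul _ _ _ _
  let W' : Submodule k[G] (B →₀ ρ.asModule) :=
    { carrier := {v | (v : B →₀ X) ∈ W}
      add_mem' := fun h1 h2 => W.add_mem h1 h2
      zero_mem' := W.zero_mem
      smul_mem' := by
        intro a v hv
        induction a using MonoidAlgebra.induction_linear with
        | zero => rw [zero_smul]; exact W.zero_mem
        | add a b h1 h2 => rw [add_smul]; exact W.add_mem h1 h2
        | single g r =>
          rw [hs]
          exact W.smul_mem _ (hW g v hv) }
  obtain ⟨C, hC⟩ := exists_isCompl W'
  let P := W'.subtype ∘ₗ Submodule.linearProjOfIsCompl W' C hC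
  refine ⟨{ toFun := P, map_add' := P.map_add, map_smul' := ?_ }, ?_, ?_, ?_⟩
  · intro r v
    have h1 : ∀ v : B →₀ ρ.asModule, (MonoidAlgebra.single 1 r : k[G]) • v = (r • (v : B →₀ X) : B →₀ X) := by
      intro v
      refine (hs 1 r v).trans ?_
      rw [map_one]
      ext b
      rfl
    exact (congrArg P (h1 v)).symm.trans ((P.map_smul _ _).trans (h1 _))
  · intro g v
    have h1 : ∀ v : B →₀ ρ.asModule, (MonoidAlgebra.single g 1 : k[G]) • v = (Finsupp.mapRange.linearMap (ρ g) (v : B →₀ X) : B →₀ X) := by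
      intro v
      refine (hs g 1 v).trans ?_
      rw [one_smul]
    exact (congrArg P (h1 v)).symm.trans ((P.map_smul _ _).trans (h1 _))
  · intro v
    exact (Submodule.linearProjOfIsCompl W' C hC v).2
  · intro v hv
    exact congrArg Subtype.val (Submodule.linearProjOfIsCompl_apply_left hC ⟨v, hv⟩)
end
end SLA

end


section
set_option linter.all false
namespace SLA
open TensorProduct
section
variable {k K G X Y : Type} [Field k] [Field K] [Algebra k K] [Group G] [AddCommGroup X] [Module k X] [AddCommGroup Y] [Module k Y]
 {ρ : Representation k G X} {σ : Representation k G Y}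

/-- averaging -/
noncomputable def av {V : Type} [AddCommGroup V] [Module K V] [Module k V] [IsScalarTower k K V] (p : V →ₗ[k] V) : K ⊗[k] K →ₗ[k] (V →ₗ[k] V) :=
  TensorProduct.lift (LinearMap.mk₂ k (fun a b => Algebra.lsmul k k V a ∘ₗ p ∘ₗ Algebra.lsmul k k V b)
   (by intros; ext; simp [add_smul]) (by intros; ext; simp)
   (by intros; ext; simp [add_smul]) (by intros; ext; simp [smul_algebra_smul_comm]))

lemma av_tmul {V : Type} [AddCommGroup V] [Module K V] [Module k V] [IsScalarTower k K V] (p : V →ₗ[k] V) (a b : K) (v : V) :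
    av p (a ⊗ₜ b) v = a • p (b • v) := rfl

/-- projections onto invariant subspaces -/
def SS (σ : Representation k G Y) : Prop := ∀ W : Submodule k Y, (∀ g, ∀ x ∈ W, σ g x ∈ W) →
  ∃ p : Y →ₗ[k] Y, Eqv σ σ p ∧ (∀ v, p v ∈ W) ∧ ∀ v ∈ W, p v = v

lemma semis [FiniteDimensional k K] [Algebra.IsSeparable k K] (hρ : Simp ρ) : SS (bc K ρ) := by
  classical
  haveI : Algebra.FormallyUnramified k K := Algebra.FormallyUnramified.of_isSeparable k K
  intro W hW
  let b := Module.Free.chooseBasis k K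
  let e : K ⊗[k] X ≃ₗ[k] _ := TensorProduct.equivFinsuppOfBasisLeft (N := X) b
  have he : ∀ g x, e (bc K ρ g x) = Finsupp.mapRange.linearMap (ρ g) (e x) := by
    intro g x
    induction x using TensorProduct.induction_on with
    | zero => simp
    | add x y h1 h2 => simp only [map_add, h1, h2]
    | tmul c x =>
      ext i
      rw [bc_tmul, Finsupp.mapRange.linearMap_apply, Finsupp.mapRange_apply,
        TensorProduct.equivFinsuppOfBasisLeft_apply_tmul_apply,
        TensorProduct.equivFinsuppOfBasisLeft_apply_tmul_apply, map_smul]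
  obtain ⟨p, hp1, hp2, hp3⟩ := ksplit _ hρ ((W.restrictScalars k).map e.toLinearMap) (by
    rintro g _ ⟨x, hx, rfl⟩
    exact ⟨bc K ρ g x, hW g x hx, he g x⟩)
  let P : K ⊗[k] X →ₗ[k] K ⊗[k] X := e.symm.toLinearMap ∘ₗ p ∘ₗ e.toLinearMap
  have hP1 : ∀ g x, P (bc K ρ g x) = bc K ρ g (P x) := by
    intro g x
    apply e.injective
    simp only [P, LinearMap.comp_apply, LinearEquiv.coe_coe, LinearEquiv.apply_symm_apply, he, hp1]
  have hP2 : ∀ v, P v ∈ W := by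
    intro v
    obtain ⟨w, hw, h⟩ := hp2 (e v)
    have : P v = w := by
      apply e.injective
      simp only [P, LinearMap.comp_apply, LinearEquiv.coe_coe, LinearEquiv.apply_symm_apply]
      exact h.symm
    rw [this]; exact hw
  have hP3 : ∀ v ∈ W, P v = v := by
    intro v hv
    apply e.injective
    simp only [P, LinearMap.comp_apply, LinearEquiv.coe_coe, LinearEquiv.apply_symm_apply]
    exact hp3 _ ⟨v, hv, rfl⟩
  let E := Algebra.FormallyUnramified.elem k K
  have a1 : ∀ (s : K) z v, av P ((1 ⊗ₜ s) * z) v = av P z (s • v) := by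
    intro s z v
    induction z using TensorProduct.induction_on with
    | zero => simp
    | add x y h1 h2 => simp only [mul_add, map_add, LinearMap.add_apply, h1, h2]
    | tmul a b => rw [Algebra.TensorProduct.tmul_mul_tmul, av_tmul, av_tmul, one_mul, smul_smul, mul_comm]
  have a2 : ∀ (s : K) z v, av P ((s ⊗ₜ 1) * z) v = s • av P z v := by
    intro s z v
    induction z using TensorProduct.induction_on with
    | zero => simp
    | add x y h1 h2 => simp only [mul_add, map_add, LinearMap.add_apply, h1, h2, smul_add]
    | tmul a b => rw [Algebra.TensorProduct.tmul_mul_tmul, av_tmul, av_tmul, one_mul, smul_smul]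
  refine ⟨{ toFun := av P E, map_add' := map_add _, map_smul' := ?_ }, ?_, ?_, ?_⟩
  · intro s v
    rw [← a1, Algebra.FormallyUnramified.one_tmul_mul_elem, a2]; rfl
  · intro g x
    show av P E (bc K ρ g x) = bc K ρ g (av P E x)
    generalize E = E
    induction E using TensorProduct.induction_on with
    | zero => simp
    | add x y h1 h2 => simp only [map_add, LinearMap.add_apply, h1, h2]
    | tmul a b => rw [av_tmul, av_tmul, ← map_smul (bc K ρ g) b, hP1, map_smul (bc K ρ g) a]
  · intro v
    show av P E v ∈ W
    generalize E = E
    induction E using TensorProduct.induction_on with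
    | zero => simp
    | add x y h1 h2 => simp only [map_add, LinearMap.add_apply]; exact W.add_mem h1 h2
    | tmul a b => rw [av_tmul]; exact W.smul_mem _ (hP2 _)
  · intro v hv
    show av P E v = v
    have : ∀ z : K ⊗[k] K, av P z v = Algebra.TensorProduct.lmul' k z • v := by
      intro z
      induction z using TensorProduct.induction_on with
      | zero => simp
      | add x y h1 h2 => simp only [map_add, LinearMap.add_apply, h1, h2, add_smul]
      | tmul a b => rw [av_tmul, hP3 _ (W.smul_mem _ hv), smul_smul]; simp
    rw [this, Algebra.FormallyUnramified.lmul_elem, one_smul]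

/-- restriction to an invariant subspace -/
def subr (σ : Representation k G Y) (W : Submodule k Y) (hW : ∀ g, ∀ x ∈ W, σ g x ∈ W) : Representation k G W where
  toFun g := (σ g).restrict (hW g)
  map_one' := by ext; simp
  map_mul' g h := by ext; simp

lemma exists_simple (σ : Representation k G Y) [FiniteDimensional k Y] (R : Submodule k Y) (hR : ∀ g, ∀ x ∈ R, σ g x ∈ R) (hR0 : R ≠ ⊥) :
    ∃ (W : Submodule k Y) (hW : ∀ g, ∀ x ∈ W, σ g x ∈ W), W ≤ R ∧ W ≠ ⊥ ∧ Simp (subr σ W hW) := by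
  obtain ⟨W, ⟨h1, h2, h3⟩, hmin⟩ := WellFounded.has_min (wellFounded_lt (α := Submodule k Y))
    {W | (∀ g, ∀ x ∈ W, σ g x ∈ W) ∧ W ≤ R ∧ W ≠ ⊥} ⟨R, hR, le_rfl, hR0⟩
  refine ⟨W, h1, h2, h3, ?_, ?_⟩
  · exact Submodule.nontrivial_iff_ne_bot.2 h3
  · intro U hU
    by_cases h0 : U = ⊥
    · exact Or.inl h0
    right
    have hle : U.map W.subtype ≤ W := Submodule.map_subtype_le _ _
    have := hmin (U.map W.subtype) ⟨?_, hle.trans h2, ?_⟩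
    · have heq : U.map W.subtype = W := by
        by_contra hne
        exact this (lt_of_le_of_ne hle hne)
      rw [eq_top_iff]
      intro x _
      have hx : (x : Y) ∈ U.map W.subtype := by rw [heq]; exact x.2
      obtain ⟨y, hy, hxy⟩ := hx
      have : y = x := Subtype.ext hxy
      rwa [← this]
    · rintro g _ ⟨x, hx, rfl⟩
      exact ⟨_, hU g x hx, rfl⟩
    · intro h
      apply h0
      rw [eq_bot_iff]
      intro x hx
      have : (x : Y) ∈ U.map W.subtype := ⟨x, hx, rfl⟩
      rw [h] at this
      rw [Submodule.mem_bot]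
      exact Subtype.ext ((Submodule.mem_bot k).1 this)
end
section
variable {K : Type} [Field K] [CharP K 3] {F : Type} [Field F] [Fintype F] {ι : F →+* K}
variable {Y : Type} [AddCommGroup Y] [Module K Y] [FiniteDimensional K Y] {σ : Representation K (Matrix.SpecialLinearGroup (Fin 2) F) Y}

lemma ss_MA {n : ℕ} (hn : 1 ≤ n) (hF : Fintype.card F = 3 ^ n) (hσ : SS σ) :
    ∀ (d : ℕ) (A : Y →ₗ[K] Y), Eqv σ σ A → Module.finrank K (LinearMap.range A) ≤ d → A ∈ MA ι σ (fun _ _ => True) := by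
  intro d
  induction d with
  | zero =>
    intro A hA hd
    have : LinearMap.range A = ⊥ := Submodule.finrank_eq_zero.1 (by omega)
    rw [LinearMap.range_eq_bot.1 this]
    exact zero_mem _
  | succ d ih =>
    intro A hA hd
    by_cases h0 : LinearMap.range A = ⊥
    · rw [LinearMap.range_eq_bot.1 h0]
      exact zero_mem _
    obtain ⟨W, hW, hWR, hW0, hs⟩ := exists_simple σ (LinearMap.range A) (by
      rintro g _ ⟨x, rfl⟩; exact ⟨σ g x, hA g x⟩) h0
    obtain ⟨p, hp, hpW, hpw⟩ := hσ W hW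
    have h1 : p ∘ₗ A ∈ MA ι σ (fun _ _ => True) := by
      have := MA.comp (cls (ι := ι) hn hF hs) (σ := σ) (f := (p ∘ₗ A).codRestrict W (fun x => hpW _)) (h := W.subtype)
        (by intro g x; ext; simp only [LinearMap.codRestrict_apply]; exact (hp.comp hA) g x) (by intro g x; rfl)
      exact this
    have h2 : A - p ∘ₗ A ∈ MA ι σ (fun _ _ => True) := by
      apply ih _ (hA.sub (hp.comp hA))
      have hle : LinearMap.range (A - p ∘ₗ A) ≤ LinearMap.range A := by
        rintro _ ⟨x, rfl⟩
        exact Submodule.sub_mem _ ⟨x, rfl⟩ (hWR (hpW _))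
      have hlt : LinearMap.range (A - p ∘ₗ A) < LinearMap.range A := by
        refine lt_of_le_of_ne hle fun heq => hW0 ?_
        rw [eq_bot_iff]
        intro w hw
        have hw' := hWR hw
        rw [← heq] at hw'
        obtain ⟨x, hx⟩ := hw'
        have h3 : p w = 0 := by
          rw [← hx]
          simp only [LinearMap.sub_apply, LinearMap.comp_apply, map_sub]
          rw [hpw _ (hpW _), sub_self]
        rw [hpw w hw] at h3
        exact (Submodule.mem_bot K).2 h3
      have := Submodule.finrank_lt_finrank_of_lt hlt
      omega
    have := add_mem h2 h1
    rwa [sub_add_cancel] at this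

variable {k : Type} [Field k] [Algebra k K] {X X' : Type} [AddCommGroup X] [Module k X] [AddCommGroup X'] [Module k X']
  {ρ : Representation k (Matrix.SpecialLinearGroup (Fin 2) F) X} {ρ' : Representation k (Matrix.SpecialLinearGroup (Fin 2) F) X'}

/-- base change property -/
def BCM (ι : F →+* K) (ρ : Representation k (Matrix.SpecialLinearGroup (Fin 2) F) X) : Prop :=
  LinearMap.id ∈ MA ι (bc K ρ) (fun _ _ => True)

lemma BCM.simp {n : ℕ} (hn : 1 ≤ n) (hF : Fintype.card F = 3 ^ n) [FiniteDimensional k K] [Algebra.IsSeparable k K]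
    [FiniteDimensional k X] (h : Simp ρ) : BCM ι ρ :=
  ss_MA hn hF (semis h) _ _ Eqv.id le_rfl

lemma BCM.tensor (h : BCM ι ρ) (h' : BCM ι ρ') : BCM ι (ρ.tprod ρ') := by
  have := MA.tensor h h'
  rw [TensorProduct.map_id] at this
  refine MA.retract this bc_tensor (Eqv.symm bc_tensor) ?_
  ext; simp

lemma BCM.retract (h : BCM ι ρ) {f : X' →ₗ[k] X} {r : X →ₗ[k] X'} (hf : Eqv ρ' ρ f) (hr : Eqv ρ ρ' r)
    (e : r ∘ₗ f = LinearMap.id) : BCM ι ρ' := by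
  refine MA.retract h hf.bc hr.bc ?_
  rw [← LinearMap.baseChange_comp, e, LinearMap.baseChange_id]
end
end SLA

end


section
set_option linter.all false
namespace SLA
section
variable {k G X Y Z : Type} [Field k] [Group G] [AddCommGroup X] [Module k X] [AddCommGroup Y] [Module k Y]
 [AddCommGroup Z] [Module k Z]
 {ρ : Representation k G X} {σ : Representation k G Y} {τ : Representation k G Z}

/-- indecomposability -/
def Ind (ρ : Representation k G X) : Prop := Nontrivial X ∧ ∀ e : X →ₗ[k] X, Eqv ρ ρ e → e ∘ₗ e = e → e = 0 ∨ e = LinearMap.id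

/-- retracts -/
def Ret (ρ : Representation k G X) (σ : Representation k G Y) : Prop :=
  ∃ (i : X →ₗ[k] Y) (r : Y →ₗ[k] X), Eqv ρ σ i ∧ Eqv σ ρ r ∧ r ∘ₗ i = LinearMap.id

lemma Eqv.pow {A : Module.End k X} (hA : Eqv ρ ρ A) (n : ℕ) : Eqv ρ ρ (A ^ n) := by
  induction n with
  | zero => exact Eqv.id
  | succ n ih => rw [pow_succ]; exact ih.comp hA

lemma bij_inv {A : X →ₗ[k] X} (hA : Eqv ρ ρ A) (hb : Function.Bijective A) :
    ∃ B : X →ₗ[k] X, Eqv ρ ρ B ∧ B ∘ₗ A = LinearMap.id ∧ A ∘ₗ B = LinearMap.id := by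
  let e := LinearEquiv.ofBijective A hb
  have he : Eqv ρ ρ e.toLinearMap := hA
  refine ⟨e.symm.toLinearMap, he.symm, ?_, ?_⟩
  · ext x; exact e.symm_apply_apply x
  · ext x; exact e.apply_symm_apply x

lemma fitting [FiniteDimensional k X] (h : Ind ρ) {A : Module.End k X} (hA : Eqv ρ ρ A) :
    Function.Bijective A ∨ IsNilpotent A := by
  haveI := h.1
  obtain ⟨m, hm1, hm⟩ := ((Filter.eventually_ge_atTop 1).and (LinearMap.eventually_isCompl_ker_pow_range_pow A)).exists
  set B := A ^ m with hB
  have hBe : Eqv ρ ρ B := hA.pow m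
  let C := LinearMap.range B
  let D := LinearMap.ker B
  have hc : IsCompl C D := hm.symm
  let P := C.subtype ∘ₗ Submodule.linearProjOfIsCompl C D hc
  have hPC : ∀ x ∈ C, P x = x := fun x hx => congrArg Subtype.val (Submodule.linearProjOfIsCompl_apply_left hc ⟨x, hx⟩)
  have hPD : ∀ x ∈ D, P x = 0 := fun x hx => congrArg Subtype.val (Submodule.linearProjOfIsCompl_apply_right hc ⟨x, hx⟩)
  have hPm : ∀ x, P x ∈ C := fun x => (Submodule.linearProjOfIsCompl C D hc x).2
  have hPe : Eqv ρ ρ P := by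
    intro g x
    have hx : x ∈ C ⊔ D := by rw [hc.sup_eq_top]; trivial
    obtain ⟨c, hcc, d, hd, rfl⟩ := Submodule.mem_sup.1 hx
    have h1 : ρ g c ∈ C := by
      obtain ⟨y, rfl⟩ := hcc
      exact ⟨ρ g y, hBe g y⟩
    have h2 : ρ g d ∈ D := by
      rw [LinearMap.mem_ker] at hd ⊢
      rw [hBe, hd, map_zero]
    simp only [map_add]
    rw [hPC _ hcc, hPD _ hd, hPC _ h1, hPD _ h2, map_zero]
  rcases h.2 P hPe (by ext x; exact hPC _ (hPm x)) with h0 | h0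
  · right
    refine ⟨m, ?_⟩
    rw [← hB]
    ext x
    rw [← hPC (B x) ⟨x, rfl⟩, h0]; rfl
  · left
    have hsurj : Function.Surjective A := by
      intro x
      have : x ∈ C := by
        have := hPm x
        rw [h0] at this
        exact this
      obtain ⟨y, hy⟩ := this
      refine ⟨(A ^ (m - 1)) y, ?_⟩
      rw [← hy, hB, ← Module.End.mul_apply, ← pow_succ', Nat.sub_add_cancel hm1]
    exact ⟨LinearMap.injective_iff_surjective.2 hsurj, hsurj⟩

lemma local_add [FiniteDimensional k X] (h : Ind ρ) {A B : X →ₗ[k] X} (hA : Eqv ρ ρ A) (hB : Eqv ρ ρ B)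
    (hb : Function.Bijective (A + B)) : Function.Bijective A ∨ Function.Bijective B := by
  obtain ⟨U, hU, hU1, hU2⟩ := bij_inv (hA.add hB) hb
  have key : ∀ C : X →ₗ[k] X, Function.Bijective (U ∘ₗ C) → Function.Bijective C := by
    intro C hC
    have hi : Function.Injective C := by
      have := hC.1
      rw [LinearMap.coe_comp] at this
      exact this.of_comp
    exact ⟨hi, LinearMap.injective_iff_surjective.1 hi⟩
  rcases fitting h (hU.comp hA) with h1 | h1
  · exact Or.inl (key A h1)
  · right
    apply key
    have h2 : U ∘ₗ B = 1 - U ∘ₗ A := by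
      rw [eq_sub_iff_add_eq, ← LinearMap.comp_add, add_comm B A, hU1]; rfl
    rw [h2, ← Module.End.isUnit_iff]
    exact IsNilpotent.isUnit_one_sub h1

lemma Ret.of_bij {i : X →ₗ[k] Y} {r : Y →ₗ[k] X} (hi : Eqv ρ σ i) (hr : Eqv σ ρ r) (hb : Function.Bijective (r ∘ₗ i)) :
    Ret ρ σ := by
  obtain ⟨U, hU, hU1, hU2⟩ := bij_inv (hr.comp hi) hb
  exact ⟨i, U ∘ₗ r, hi, hU.comp hr, hU1⟩

lemma Ret.iso (h : Ret ρ σ) (hρ : Ind ρ) (hσ : Ind σ) : ∃ (i : X →ₗ[k] Y) (r : Y →ₗ[k] X), Eqv ρ σ i ∧ Eqv σ ρ r ∧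
    r ∘ₗ i = LinearMap.id ∧ i ∘ₗ r = LinearMap.id := by
  haveI := hρ.1
  obtain ⟨i, r, hi, hr, e⟩ := h
  refine ⟨i, r, hi, hr, e, ?_⟩
  have hid : (i ∘ₗ r) ∘ₗ (i ∘ₗ r) = i ∘ₗ r := by
    calc (i ∘ₗ r) ∘ₗ (i ∘ₗ r) = i ∘ₗ (r ∘ₗ i) ∘ₗ r := rfl
      _ = i ∘ₗ r := by rw [e]; rfl
  rcases hσ.2 (i ∘ₗ r) (hi.comp hr) hid with h0 | h0
  · exfalso
    have : (LinearMap.id : X →ₗ[k] X) = 0 := by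
      calc LinearMap.id = (r ∘ₗ i) ∘ₗ (r ∘ₗ i) := by rw [e]; rfl
        _ = r ∘ₗ (i ∘ₗ r) ∘ₗ i := rfl
        _ = 0 := by rw [h0]; simp
    obtain ⟨x, hx⟩ := exists_ne (0 : X)
    exact hx (LinearMap.congr_fun this x)
  · exact h0

lemma Ret.split [FiniteDimensional k X] (hρ : Ind ρ) (h : Ret ρ τ) {i1 : Y →ₗ[k] Z} {r1 : Z →ₗ[k] Y}
    (hi1 : Eqv σ τ i1) (hr1 : Eqv τ σ r1) (e1 : r1 ∘ₗ i1 = LinearMap.id)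
    (hK : ∀ g, ∀ x ∈ LinearMap.ker r1, τ g x ∈ LinearMap.ker r1) :
    Ret ρ σ ∨ Ret ρ (subr τ (LinearMap.ker r1) hK) := by
  obtain ⟨i, r, hi, hr, e⟩ := h
  have e1' : ∀ y, r1 (i1 y) = y := fun y => LinearMap.congr_fun e1 y
  let q : X →ₗ[k] LinearMap.ker r1 := (i - i1 ∘ₗ r1 ∘ₗ i).codRestrict _ (by
    intro x; rw [LinearMap.mem_ker]; simp [e1'])
  have hq : Eqv ρ (subr τ (LinearMap.ker r1) hK) q := by
    intro g x
    apply Subtype.ext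
    exact (hi.sub (hi1.comp (hr1.comp hi))) g x
  have hs : Eqv (subr τ (LinearMap.ker r1) hK) ρ (r ∘ₗ (LinearMap.ker r1).subtype) := by
    intro g x
    exact hr g x
  have hsum : (r ∘ₗ i1) ∘ₗ (r1 ∘ₗ i) + (r ∘ₗ (LinearMap.ker r1).subtype) ∘ₗ q = LinearMap.id := by
    rw [← e]
    ext x
    simp [q]
  rcases local_add hρ ((hr.comp hi1).comp (hr1.comp hi)) (hs.comp hq) (by rw [hsum]; exact Function.bijective_id) with h1 | h1
  · exact Or.inl (Ret.of_bij (hr1.comp hi) (hr.comp hi1) h1)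
  · exact Or.inr (Ret.of_bij hq hs h1)
end

section
open TensorProduct
variable {k K G V : Type} [Field k] [Field K] [Algebra k K] [Group G] [AddCommGroup V] [Module K V] [Module k V] [IsScalarTower k K V]
/-- restriction of scalars -/
def resk (k : Type) [Field k] [Algebra k K] [Module k V] [IsScalarTower k K V] (τ : Representation K G V) : Representation k G V where
  toFun g := (τ g).restrictScalars k
  map_one' := by rw [map_one]; rfl
  map_mul' g h := by rw [map_mul]; rfl
end

section
open TensorProduct
variable {K : Type} [Field K] [CharP K 3] {F : Type} [Field F] [Fintype F] {ι : F →+* K}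
variable {k : Type} [Field k] [Algebra k K] {X : Type} [AddCommGroup X] [Module k X] [FiniteDimensional k X]
  {ρ : Representation k (Matrix.SpecialLinearGroup (Fin 2) F) X}

lemma BCM.ret {n : ℕ} (hn : 1 ≤ n) (hF : Fintype.card F = 3 ^ n) (h : BCM ι ρ) (hI : Ind ρ) :
    ∃ (r : ℕ) (c : Fin r → ℕ), (r ≤ 4 * n ∧ ∀ j, c j < n) ∧ Ret ρ (resk k (monRep ι c)) := by
  have hb := MA.bound hF hn h
  obtain ⟨lam, hlam⟩ := LinearMap.exists_leftInverse_of_injective (Algebra.linearMap k K)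
    (LinearMap.ker_eq_bot.2 (algebraMap k K).injective)
  have hl1 : lam 1 = 1 := by
    have := LinearMap.congr_fun hlam 1
    simpa using this
  let j : X →ₗ[k] K ⊗[k] X := TensorProduct.mk k K X 1
  let s : K ⊗[k] X →ₗ[k] X := (TensorProduct.lid k X).toLinearMap ∘ₗ lam.rTensor X
  have hj : ∀ g x, j (ρ g x) = bc K ρ g (j x) := fun g x => rfl
  have hs : ∀ g x, s (bc K ρ g x) = ρ g (s x) := by
    intro g x
    induction x using TensorProduct.induction_on with
    | zero => simp
    | add x y h1 h2 => simp only [map_add, h1, h2]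
    | tmul a b => simp [s, bc_tmul]
  have hsj : ∀ x, s (j x) = x := by intro x; simp [s, j, hl1]
  by_contra hcon
  push Not at hcon
  have main : ∀ A ∈ MA ι (bc K ρ) (fun r c => r ≤ 4 * n ∧ ∀ j, c j < n),
      Eqv ρ ρ (s ∘ₗ A.restrictScalars k ∘ₗ j) ∧ ¬ Function.Bijective (s ∘ₗ A.restrictScalars k ∘ₗ j) := by
    haveI := hI.1
    intro A hA
    induction hA using AddSubgroup.closure_induction with
    | zero =>
      have : s ∘ₗ (0 : K ⊗[k] X →ₗ[K] K ⊗[k] X).restrictScalars k ∘ₗ j = 0 := by ext; simp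
      rw [this]
      refine ⟨Eqv.zero, fun hb => ?_⟩
      obtain ⟨x, hx⟩ := exists_ne (0 : X)
      exact hx (hb.1 (by simp))
    | add A B _ _ h1 h2 =>
      have : s ∘ₗ (A + B).restrictScalars k ∘ₗ j = s ∘ₗ A.restrictScalars k ∘ₗ j + s ∘ₗ B.restrictScalars k ∘ₗ j := by
        ext; simp
      rw [this]
      refine ⟨h1.1.add h2.1, fun hb => ?_⟩
      rcases local_add hI h1.1 h2.1 hb with h | h
      · exact h1.2 h
      · exact h2.2 h
    | neg A _ h1 =>
      have : s ∘ₗ (-A).restrictScalars k ∘ₗ j = - (s ∘ₗ A.restrictScalars k ∘ₗ j) := by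
        ext; simp
      rw [this]
      refine ⟨h1.1.neg, fun hb => h1.2 ?_⟩
      have hi : Function.Injective (s ∘ₗ A.restrictScalars k ∘ₗ j) := by
        intro x y hxy
        apply hb.1
        rw [LinearMap.neg_apply, LinearMap.neg_apply, hxy]
      exact ⟨hi, LinearMap.injective_iff_surjective.1 hi⟩
    | mem A hA =>
      obtain ⟨r, c, hp, f, h, hf, hh, rfl⟩ := hA
      have h1 : Eqv ρ (resk k (monRep ι c)) (f.restrictScalars k ∘ₗ j) := by
        intro g x
        show f (j (ρ g x)) = monRep ι c g (f (j x))
        rw [hj, hf]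
      have h2 : Eqv (resk k (monRep ι c)) ρ (s ∘ₗ h.restrictScalars k) := by
        intro g x
        show s (h (monRep ι c g x)) = ρ g (s (h x))
        rw [hh, hs]
      refine ⟨h2.comp h1, fun hb => hcon r c hp (Ret.of_bij h1 h2 hb)⟩
  have := (main _ hb).2
  apply this
  have h3 : s ∘ₗ (LinearMap.id : K ⊗[k] X →ₗ[K] K ⊗[k] X).restrictScalars k ∘ₗ j = LinearMap.id := by
    ext x; exact hsj x
  rw [h3]
  exact Function.bijective_id
end
end SLA

end


section
set_option linter.all false
namespace SLA
section
variable {k G S : Type} [Field k] [Group G] [Group S] (π : S →* G) 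
/-- underlying linear map -/
def lin {M N : FDRep k G} (f : M ⟶ N) : M →ₗ[k] N := f.hom.hom.hom
lemma lin_eqv {M N : FDRep k G} (f : M ⟶ N) : Eqv M.ρ N.ρ (lin f) := by
  intro g x
  have := f.comm g
  have h2 := congrArg (fun (a : M.V ⟶ N.V) => a.hom.hom x) this
  exact h2
/-- morphism from an equivariant map -/
def mkh {M N : FDRep k G} (f : M →ₗ[k] N) (hf : Eqv M.ρ N.ρ f) : M ⟶ N where
  hom := FGModuleCat.ofHom f
  comm := by
    intro g
    ext x
    exact hf g x
lemma lin_mkh {M N : FDRep k G} (f : M →ₗ[k] N) (hf : Eqv M.ρ N.ρ f) : lin (mkh f hf) = f := rfl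
lemma lin_comp {M N P : FDRep k G} (f : M ⟶ N) (g : N ⟶ P) : lin (f ≫ g) = lin g ∘ₗ lin f := rfl
lemma lin_id (M : FDRep k G) : lin (𝟙 M) = LinearMap.id := rfl
lemma lin_zero (M N : FDRep k G) : lin (0 : M ⟶ N) = 0 := rfl
lemma lin_inj {M N : FDRep k G} {f g : M ⟶ N} (h : lin f = lin g) : f = g := by
  ext x
  exact LinearMap.congr_fun h x

/-- inflation -/
noncomputable def infl (π : S →* G) (N : FDRep k G) : Representation k S N := (show G →* (N →ₗ[k] N) from N.ρ).comp π

variable {π}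
lemma infl_eqv {M N : FDRep k G} (f : M ⟶ N) : Eqv (infl π M) (infl π N) (lin f) := fun g x => lin_eqv f (π g) x
lemma eqv_of_infl (hπ : Function.Surjective π) {M N : FDRep k G} {f : M →ₗ[k] N} (hf : Eqv (infl π M) (infl π N) f) :
    Eqv M.ρ N.ρ f := by
  intro g x
  obtain ⟨s, rfl⟩ := hπ g
  exact hf s x

lemma nontriv_of {N : FDRep k G} (h : ¬ Limits.IsZero N) : Nontrivial N := by
  by_contra hcon
  rw [not_nontrivial_iff_subsingleton] at hcon
  apply h
  rw [Limits.IsZero.iff_id_eq_zero]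
  apply lin_inj
  ext x
  exact Subsingleton.elim _ _

lemma ind_infl (hπ : Function.Surjective π) {N : FDRep k G} (h : AlgebraicModule.Indecomposable N) : Ind (infl π N) := by
  refine ⟨nontriv_of h.1, ?_⟩
  intro e he hee
  have he' := eqv_of_infl hπ he
  rcases h.2 (mkh e he') (lin_inj hee) with h0 | h0
  · left; exact congrArg lin h0
  · right; exact congrArg lin h0

lemma fin_list (hπ : Function.Surjective π) (d : ℕ) : ∀ (Z : Type) [AddCommGroup Z] [Module k Z] [FiniteDimensional k Z]
    (τ : Representation k S Z), Module.finrank k Z ≤ d → ∃ L : List (FDRep k G), ∀ N : FDRep k G, AlgebraicModule.Indecomposable N →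
      Ret (infl π N) τ → ∃ N' ∈ L, Nonempty (N ≅ N') := by
  induction d with
  | zero =>
    intro Z _ _ _ τ hd
    refine ⟨[], ?_⟩
    rintro N hN ⟨i, r, -, -, e⟩
    exfalso
    haveI := nontriv_of hN.1
    haveI : Subsingleton Z := (Module.finrank_zero_iff (R := k)).1 (by omega)
    obtain ⟨x, hx⟩ := exists_ne (0 : N)
    apply hx
    have := LinearMap.congr_fun e x
    have h2 : r (i x) = x := this
    rw [← h2, Subsingleton.elim (i x) 0, map_zero]
  | succ d ih =>
    intro Z _ _ _ τ hd
    by_cases hex : ∃ N : FDRep k G, AlgebraicModule.Indecomposable N ∧ Ret (infl π N) τ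
    · obtain ⟨N1, hN1, i1, r1, hi1, hr1, e1⟩ := hex
      haveI := nontriv_of hN1.1
      have hK : ∀ g, ∀ x ∈ LinearMap.ker r1, τ g x ∈ LinearMap.ker r1 := by
        intro g x hx
        rw [LinearMap.mem_ker] at hx ⊢
        rw [hr1, hx, map_zero]
      have hlt : Module.finrank k (LinearMap.ker r1) < Module.finrank k Z := by
        apply Submodule.finrank_lt
        intro htop
        obtain ⟨x, hx⟩ := exists_ne (0 : N1)
        apply hx
        have h1 : i1 x ∈ LinearMap.ker r1 := by rw [htop]; trivial
        have h2 : r1 (i1 x) = x := LinearMap.congr_fun e1 x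
        rw [← h2]; exact h1
      obtain ⟨L, hL⟩ := ih (LinearMap.ker r1) (subr τ _ hK) (by omega)
      refine ⟨N1 :: L, ?_⟩
      intro N hN hR
      have hI := ind_infl hπ hN
      rcases hR.split hI hi1 hr1 e1 hK with h | h
      · obtain ⟨i, r, hi, hr, e, e'⟩ := h.iso hI (ind_infl hπ hN1)
        refine ⟨N1, by simp, ⟨?_⟩⟩
        exact { hom := mkh i (eqv_of_infl hπ hi), inv := mkh r (eqv_of_infl hπ hr),
                hom_inv_id := lin_inj e, inv_hom_id := lin_inj e' }
      · obtain ⟨N', hN', h⟩ := hL N hN h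
        exact ⟨N', by simp [hN'], h⟩
    · refine ⟨[], ?_⟩
      intro N hN hR
      exact absurd ⟨N, hN, hR⟩ hex

lemma simp_of {M : FDRep k G} (hπ : Function.Surjective π) (hM : Simple M) : Simp (infl π M) := by
  refine ⟨nontriv_of (Simple.not_isZero M), ?_⟩
  intro W hW
  have hW' : ∀ g, ∀ x ∈ W, M.ρ g x ∈ W := by
    intro g x hx
    obtain ⟨s, rfl⟩ := hπ g
    exact hW s x hx
  let U : FDRep k G := FDRep.of (subr M.ρ W hW')
  let f : U ⟶ M := mkh W.subtype (fun g x => rfl)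
  haveI : Mono f := by
    constructor
    intro Z a b hab
    apply lin_inj
    ext x
    have := LinearMap.congr_fun (congrArg lin hab) x
    exact this
  by_cases hf : f = 0
  · left
    rw [eq_bot_iff]
    intro x hx
    have := LinearMap.congr_fun (congrArg lin hf) (⟨x, hx⟩ : W)
    exact (Submodule.mem_bot k).2 this
  · right
    haveI := isIso_of_mono_of_nonzero hf
    rw [eq_top_iff]
    intro x _
    have h1 := congrArg lin (IsIso.inv_hom_id f)
    have h2 := LinearMap.congr_fun h1 x
    have h3 : (lin (inv f) x : W).1 = x := h2
    rw [← h3]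
    exact (lin (inv f) x : W).2
end

lemma exists_K (n : ℕ) (hn : 1 ≤ n) (k : Type) [Field k] [CharP k 3] :
    ∃ (K : Type) (_ : Field K) (_ : Algebra k K), FiniteDimensional k K ∧ Algebra.IsSeparable k K ∧ CharP K 3 ∧ Nonempty (GaloisField 3 n →+* K) := by
  let p : Polynomial k := Polynomial.X ^ (3 ^ n) - Polynomial.X
  have hsep : p.Separable := galois_poly_separable 3 _ (dvd_pow_self 3 (by omega))
  haveI : CharP p.SplittingField 3 := charP_of_injective_algebraMap (algebraMap k p.SplittingField).injective 3
  haveI := IsGalois.of_separable_splitting_field (F := k) (E := p.SplittingField) hsep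
  refine ⟨p.SplittingField, inferInstance, inferInstance, inferInstance, inferInstance, inferInstance, ?_⟩
  letI : Algebra (ZMod 3) p.SplittingField := ZMod.algebra _ 3
  let P : Polynomial (ZMod 3) := Polynomial.X ^ (3 ^ n) - Polynomial.X
  have hs : (P.map (algebraMap (ZMod 3) p.SplittingField)).Splits := by
    have := Polynomial.SplittingField.splits p
    simpa [p, P] using this
  exact ⟨(Polynomial.SplittingField.lift P hs).toRingHom⟩

section
variable {k G F K : Type} [Field k] [Group G] [Field F] [Fintype F] [Field K] [Algebra k K]
  {π : Matrix.SpecialLinearGroup (Fin 2) F →* G}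
/-- to the tensor product -/
def toT (M N : FDRep k G) : (M ⊗ N : FDRep k G) →ₗ[k] TensorProduct k M N where
  toFun x := x
  map_add' _ _ := rfl
  map_smul' _ _ := rfl
/-- from the tensor product -/
def ofT (M N : FDRep k G) : TensorProduct k M N →ₗ[k] (M ⊗ N : FDRep k G) where
  toFun x := x
  map_add' _ _ := rfl
  map_smul' _ _ := rfl
lemma toT_eqv (M N : FDRep k G) : Eqv (infl π (M ⊗ N)) ((infl π M).tprod (infl π N)) (toT M N) := fun g x => rfl
lemma ofT_eqv (M N : FDRep k G) : Eqv ((infl π M).tprod (infl π N)) (infl π (M ⊗ N)) (ofT M N) := fun g x => rfl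
lemma ofT_toT (M N : FDRep k G) : ofT M N ∘ₗ toT M N = LinearMap.id := rfl
end

theorem main (n : ℕ) (hn : 1 ≤ n)
    (k : Type) [Field k] (hk : CharP k 3)
    (M : FDRep k (PSL 2 (GaloisField 3 n))) (hM : Simple M) : IsAlgebraic M := by
  classical
  obtain ⟨K, _, _, _, _, _, ⟨ι⟩⟩ := exists_K n hn k
  haveI : Fintype (GaloisField 3 n) := Fintype.ofFinite _
  have hF : Fintype.card (GaloisField 3 n) = 3 ^ n := by
    rw [← Nat.card_eq_fintype_card]; exact GaloisField.card 3 n (by omega)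
  let π : Matrix.SpecialLinearGroup (Fin 2) (GaloisField 3 n) →* PSL 2 (GaloisField 3 n) := QuotientGroup.mk' _
  have hπ : Function.Surjective π := QuotientGroup.mk'_surjective _
  have hB0 : BCM ι (infl π M) := BCM.simp hn hF (simp_of hπ hM)
  have hB : ∀ m, BCM ι (infl π (tensorPow M m)) := by
    intro m
    induction m with
    | zero => exact hB0
    | succ m ih => exact (BCM.tensor ih hB0).retract (toT_eqv _ _) (ofT_eqv _ _) (ofT_toT _ _)
  let T := Σ r : Fin (4 * n + 1), (Fin r.1 → Fin n)
  have hc : ∀ t : T, ∃ L : List (FDRep k (PSL 2 (GaloisField 3 n))), ∀ N, AlgebraicModule.Indecomposable N →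
      Ret (infl π N) (resk k (monRep ι (fun j => (t.2 j).1))) → ∃ N' ∈ L, Nonempty (N ≅ N') := by
    intro t
    exact fin_list hπ _ _ _ le_rfl
  choose L hL using hc
  refine ⟨(Finset.univ : Finset T).toList.flatMap L, ?_⟩
  rintro N hN ⟨m, i, r, hir⟩
  have hBN : BCM ι (infl π N) := (hB m).retract (infl_eqv i) (infl_eqv r) (congrArg lin hir)
  obtain ⟨s, c, ⟨hs, hcn⟩, hR⟩ := hBN.ret hn hF (ind_infl hπ hN)
  obtain ⟨N', hN', h⟩ := hL ⟨⟨s, by omega⟩, fun j => ⟨c j, hcn j⟩⟩ N hN hR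
  exact ⟨N', List.mem_flatMap.2 ⟨_, by simp, hN'⟩, h⟩
end SLA

end

/-- For `q = 3^n` and `k` a field of characteristic `3`, every simple `k PSL_2(q)`-module
is algebraic. -/
theorem psl2_char3_simple_algebraic (n : ℕ) (hn : 1 ≤ n)
    (k : Type) [Field k] (hk : CharP k 3)
    (M : FDRep k (PSL 2 (GaloisField 3 n))) (hM : Simple M) : IsAlgebraic M := by
  exact SLA.main n hn k hk M hM
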